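/- arXiv:1306.0136 — 6 statements merged into one kernel-verified Lean document; each statement's English description precedes it below -/
import Mathlib

section
/- For every nonnegative integer k, the number of 9-regular partitions of 4k+3 is divisible by 3, i.e., b_9(4k+3) ≡ 0 (mod 3). -/
/-- `numRegular ℓ n` is the number of `ℓ`-regular partitions of `n`,
i.e. partitions of `n` none of whose parts is divisible by `ℓ`. -/
def numRegular (ℓ n : ℕ) : ℕ :=
  (Finset.univ.filter fun p : Nat.Partition n => ∀ i ∈ p.parts, ¬ ℓ ∣ i).card

open Finset

section Gauss

variable {R : Type*} [CommRing R]

/-- The summand of Shanks' finite form of Gauss's identity, cleared of denominators. -/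
def gaussTerm (x : R) (n s : ℕ) : R :=
  (-1) ^ s * x ^ ((n + 1) * s) * (∏ i ∈ range s, (1 + x ^ i)) * ∏ i ∈ Ico s n, (1 - x ^ (i + 1))

/-- The sum of `x ^ (k ^ 2)` over the integers `k` of absolute value at most `n` satisfying `p`. -/
noncomputable def squareSum (p : ℤ → Prop) [DecidablePred p] (n : ℕ) (x : R) : R :=
  ∑ k ∈ Icc (-n : ℤ) n with p k, x ^ (k.natAbs ^ 2)

theorem sum_gaussTerm_sub (x : R) {n k : ℕ} (hk : k ≤ n) :
    ∑ s ∈ range (k + 1), (gaussTerm x (n + 1) s - (1 + x ^ (n + 1)) * gaussTerm x n s) =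
      (-1) ^ (k + 1) * x ^ ((n + 1) * (k + 1)) * (∏ i ∈ range (k + 1), (1 + x ^ i)) *
        ∏ i ∈ Ico k n, (1 - x ^ (i + 1)) := by
  induction k with
  | zero =>
    simp [gaussTerm, prod_range_succ]
    ring
  | succ k ih =>
    rw [sum_range_succ, ih (by omega), prod_range_succ _ (k + 1),
      prod_eq_prod_Ico_succ_bot (by omega : k < n), gaussTerm, gaussTerm,
      prod_Ico_succ_top (by omega : k + 1 ≤ n)]
    ring

theorem sum_gaussTerm_succ (x : R) (n : ℕ) :
    ∑ s ∈ range (n + 2), gaussTerm x (n + 1) s =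
      (1 + x ^ (n + 1)) * ∑ s ∈ range (n + 1), gaussTerm x n s +
        2 * (-1) ^ (n + 1) * x ^ ((n + 1) ^ 2) * ∏ i ∈ range (n + 1), (1 + x ^ (i + 1)) := by
  have h := sum_gaussTerm_sub x (le_refl n)
  rw [sum_sub_distrib, ← mul_sum, sub_eq_iff_eq_add] at h
  have h2 : (∏ i ∈ range (n + 1), (1 + x ^ i)) * (1 + x ^ (n + 1)) =
      (∏ i ∈ range (n + 1), (1 + x ^ (i + 1))) * 2 := by
    rw [← prod_range_succ (fun i => 1 + x ^ i), prod_range_succ' (fun i => 1 + x ^ i)]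
    norm_num
  rw [sum_range_succ, h, gaussTerm]
  simp only [Ico_self, prod_empty]
  linear_combination (-1) ^ (n + 1) * x ^ ((n + 1) ^ 2) * h2

theorem Icc_neg_succ (n : ℕ) :
    Icc (-((n + 1 : ℕ) : ℤ)) ((n + 1 : ℕ) : ℤ) =
      insert (-((n : ℤ) + 1)) (insert ((n : ℤ) + 1) (Icc (-(n : ℤ)) n)) := by
  ext k
  simp only [mem_Icc, mem_insert]
  omega

theorem squareSum_even_sub_odd_succ (x : R) (n : ℕ) :
    squareSum Even (n + 1) x - squareSum Odd (n + 1) x =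
      squareSum Even n x - squareSum Odd n x + 2 * (-1) ^ (n + 1) * x ^ ((n + 1) ^ 2) := by
  have h1 : -((n : ℤ) + 1) ∉ insert ((n : ℤ) + 1) (Icc (-(n : ℤ)) n) := by
    simp only [mem_Icc, mem_insert]; omega
  have h2 : (n : ℤ) + 1 ∉ Icc (-(n : ℤ)) n := by simp
  have h3 : ((n : ℤ) + 1).natAbs = n + 1 := by omega
  have h4 : Even ((n : ℤ) + 1) ↔ Even (n + 1) := by exact_mod_cast Int.even_coe_nat (n + 1)
  simp only [squareSum, sum_filter, Icc_neg_succ, sum_insert h1, sum_insert h2, Int.natAbs_neg, h3,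
    ← Int.not_even_iff_odd, even_neg, h4]
  rcases Nat.even_or_odd (n + 1) with h | h
  · simp only [h, h.neg_one_pow, not_true, if_true, if_false]
    ring
  · simp only [Nat.not_even_iff_odd.2 h, h.neg_one_pow, not_false_iff, if_true, if_false]
    ring

theorem prod_one_add_mul_squareSum (x : R) (n : ℕ) :
    (∏ i ∈ range n, (1 + x ^ (i + 1))) * (squareSum Even n x - squareSum Odd n x) =
      ∑ s ∈ range (n + 1), gaussTerm x n s := by
  induction n with
  | zero => simp [squareSum, gaussTerm, filter_singleton]
  | succ n ih =>
    rw [sum_gaussTerm_succ, ← ih, squareSum_even_sub_odd_succ, prod_range_succ]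
    ring

/-- Gauss's identity `∏ (1 - x ^ i) ^ 2 = ∏ (1 - x ^ (2 * i)) * ∑ (-1) ^ k * x ^ (k ^ 2)`, modulo
`x ^ (n + 1)`. -/
theorem pow_succ_dvd_gauss (x : R) (n : ℕ) :
    x ^ (n + 1) ∣ (∏ i ∈ range n, (1 - x ^ (i + 1))) ^ 2 -
      (∏ i ∈ range n, (1 - (x ^ 2) ^ (i + 1))) *
        (squareSum Even n x - squareSum Odd n x) := by
  have h1 : ∏ i ∈ range n, (1 - (x ^ 2) ^ (i + 1)) =
      (∏ i ∈ range n, (1 - x ^ (i + 1))) * ∏ i ∈ range n, (1 + x ^ (i + 1)) := by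
    rw [← prod_mul_distrib]
    exact prod_congr rfl fun i _ => by ring
  have h2 : x ^ (n + 1) ∣ ∑ s ∈ range n, gaussTerm x n (s + 1) :=
    dvd_sum fun s _ => by
      rw [gaussTerm, mul_assoc, mul_assoc]
      exact ((pow_dvd_pow x (Nat.le_mul_of_pos_right _ s.succ_pos)).mul_right _).mul_left _
  rw [h1, mul_assoc, prod_one_add_mul_squareSum, sum_range_succ', mul_add]
  have h3 : gaussTerm x n 0 = ∏ i ∈ range n, (1 - x ^ (i + 1)) := by simp [gaussTerm]
  rw [h3, ← sq, sub_add_cancel_right]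
  exact (h2.mul_left _).neg_right

end Gauss

section Support

open PowerSeries

variable {R : Type*} [CommRing R] {d : ℕ}

/-- All exponents occurring in `f` are congruent to `r` modulo `d`. -/
def ExponentsIn (r : ZMod d) (f : R⟦X⟧) : Prop :=
  ∀ n : ℕ, (n : ZMod d) ≠ r → coeff n f = 0

theorem ExponentsIn.add {r : ZMod d} {f g : R⟦X⟧} (hf : ExponentsIn r f) (hg : ExponentsIn r g) :
    ExponentsIn r (f + g) := fun n hn => by
  rw [map_add, hf n hn, hg n hn, add_zero]

theorem ExponentsIn.neg {r : ZMod d} {f : R⟦X⟧} (hf : ExponentsIn r f) :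
    ExponentsIn r (-f) := fun n hn => by
  rw [map_neg, hf n hn, neg_zero]

theorem ExponentsIn.sub {r : ZMod d} {f g : R⟦X⟧} (hf : ExponentsIn r f) (hg : ExponentsIn r g) :
    ExponentsIn r (f - g) :=
  sub_eq_add_neg f g ▸ hf.add hg.neg

theorem ExponentsIn.mul {r s : ZMod d} {f g : R⟦X⟧} (hf : ExponentsIn r f)
    (hg : ExponentsIn s g) : ExponentsIn (r + s) (f * g) := fun n hn => by
  rw [coeff_mul]
  refine sum_eq_zero fun p hp => ?_
  rw [HasAntidiagonal.mem_antidiagonal] at hp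
  by_cases h1 : (p.1 : ZMod d) = r
  · rw [hg p.2 (fun h2 => hn (by rw [← hp, Nat.cast_add, h1, h2])), mul_zero]
  · rw [hf p.1 h1, zero_mul]

theorem ExponentsIn.castHom {r : ZMod d} {f : R⟦X⟧} (hf : ExponentsIn r f) {m : ℕ} (h : m ∣ d) :
    ExponentsIn (ZMod.castHom h (ZMod m) r) f := fun n hn =>
  hf n fun hr => hn (by rw [← hr, map_natCast])

theorem exponentsIn_X_pow {r : ZMod d} {m : ℕ} (h : (m : ZMod d) = r) :
    ExponentsIn r (X ^ m : R⟦X⟧) := fun n hn => by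
  rw [coeff_X_pow, if_neg]
  rintro rfl
  exact hn h

theorem exponentsIn_one : ExponentsIn (0 : ZMod d) (1 : R⟦X⟧) := by
  simpa using exponentsIn_X_pow (R := R) (d := d) (r := 0) (m := 0) (by simp)

theorem ExponentsIn.pow {r : ZMod d} {f : R⟦X⟧} (hf : ExponentsIn r f) (m : ℕ) :
    ExponentsIn ((m : ZMod d) * r) (f ^ m) := by
  induction m with
  | zero => simpa using exponentsIn_one
  | succ m ih =>
    rw [pow_succ, Nat.cast_succ, add_mul, one_mul]
    exact ih.mul hf

theorem ExponentsIn.sum {ι : Type*} {s : Finset ι} {f : ι → R⟦X⟧} {r : ZMod d}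
    (h : ∀ i ∈ s, ExponentsIn r (f i)) : ExponentsIn r (∑ i ∈ s, f i) := fun n hn => by
  rw [map_sum]
  exact sum_eq_zero fun i hi => h i hi n hn

theorem ExponentsIn.prod {ι : Type*} {s : Finset ι} {f : ι → R⟦X⟧}
    (h : ∀ i ∈ s, ExponentsIn (0 : ZMod d) (f i)) : ExponentsIn (0 : ZMod d) (∏ i ∈ s, f i) :=
  prod_induction f (ExponentsIn 0) (fun _ _ ha hb => by simpa using ha.mul hb) exponentsIn_one h

theorem exponentsIn_squareSum {p : ℤ → Prop} [DecidablePred p] {r : ZMod d} {m : ℕ}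
    (h : ∀ k : ℤ, p k → (m : ZMod d) * (k : ZMod d) ^ 2 = r) (n : ℕ) :
    ExponentsIn r (squareSum p n (X ^ m : R⟦X⟧)) := by
  refine ExponentsIn.sum fun k hk => ?_
  rw [← pow_mul]
  refine exponentsIn_X_pow ?_
  rw [← h k (mem_filter.1 hk).2, Nat.cast_mul]
  congr 1
  have : ((k.natAbs ^ 2 : ℕ) : ℤ) = k ^ 2 := by simp
  exact_mod_cast congrArg (Int.cast : ℤ → ZMod d) this

end Support

section TwoSquares

open PowerSeries

variable {R : Type*} [CommRing R]

theorem coeff_sum_X_pow {ι : Type*} (s : Finset ι) (f : ι → ℕ) (n : ℕ) :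
    coeff n (∑ i ∈ s, X ^ f i : R⟦X⟧) = ((s.filter fun i => n = f i).card : R) := by
  simp [coeff_X_pow]

/-- The two-square identity `x ^ 2 + y ^ 2 = 2 * (u ^ 2 + v ^ 2)` for `x = u + v`, `y = u - v`. -/
theorem card_two_squares {n N : ℕ} (hn : n ≤ N) :
    #{p ∈ {p ∈ Icc (-N : ℤ) N ×ˢ Icc (-N : ℤ) N | Even (p.1 + p.2)} |
        n = p.1.natAbs ^ 2 + p.2.natAbs ^ 2} =
      #{p ∈ Icc (-N : ℤ) N ×ˢ Icc (-N : ℤ) N |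
        n = 2 * p.1.natAbs ^ 2 + 2 * p.2.natAbs ^ 2} := by
  have habs : ∀ k : ℤ, k ^ 2 ≤ N → -(N : ℤ) ≤ k ∧ k ≤ N := fun k hk =>
    ⟨by nlinarith [sq_nonneg (k + 1), sq_nonneg k, Int.le_self_sq (-k)],
      by nlinarith [Int.le_self_sq k]⟩
  have hn' : (n : ℤ) ≤ N := by exact_mod_cast hn
  symm
  refine card_nbij' (fun p => (p.1 + p.2, p.1 - p.2))
    (fun p => ((p.1 + p.2) / 2, (p.1 - p.2) / 2)) ?_ ?_ ?_ ?_
  · rintro ⟨u, v⟩ h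
    simp only [coe_filter, mem_filter, mem_product, mem_Icc, Set.mem_ofPred_eq] at h ⊢
    have h1 : (n : ℤ) = 2 * u ^ 2 + 2 * v ^ 2 := by rw [h.2]; simp
    refine ⟨⟨⟨habs _ ?_, habs _ ?_⟩, ⟨u, by ring⟩⟩, ?_⟩
    · nlinarith [sq_nonneg (u - v)]
    · nlinarith [sq_nonneg (u + v)]
    · zify
      simp only [sq_abs]
      linarith
  · rintro ⟨x, y⟩ h
    simp only [coe_filter, mem_filter, mem_product, mem_Icc, Set.mem_ofPred_eq] at h ⊢
    have h1 : (n : ℤ) = x ^ 2 + y ^ 2 := by rw [h.2]; simp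
    obtain ⟨u, hu⟩ := h.1.2
    have hx : x = 2 * u - y := by omega
    subst hx
    have e1 : (2 * u - y + y) / 2 = u := by omega
    have e2 : (2 * u - y - y) / 2 = u - y := by omega
    rw [e1, e2]
    refine ⟨⟨habs _ ?_, habs _ ?_⟩, ?_⟩
    · nlinarith [sq_nonneg (u - y), sq_nonneg u]
    · nlinarith [sq_nonneg (u - y), sq_nonneg u]
    · zify
      simp only [sq_abs]
      linarith
  · rintro ⟨u, v⟩ _
    simp only [Prod.mk.injEq]
    omega
  · rintro ⟨x, y⟩ h
    simp only [coe_filter, mem_filter, Set.mem_ofPred_eq] at h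
    obtain ⟨u, hu⟩ := h.1.2
    simp only [Prod.mk.injEq]
    omega

theorem squareSum_even_sq_add_odd_sq (N : ℕ) (x : R) :
    squareSum Even N x ^ 2 + squareSum Odd N x ^ 2 =
      ∑ p ∈ Icc (-N : ℤ) N ×ˢ Icc (-N : ℤ) N with Even (p.1 + p.2),
        x ^ (p.1.natAbs ^ 2 + p.2.natAbs ^ 2) := by
  simp only [squareSum, sum_filter, sq (∑ _ ∈ _, _), sum_mul_sum, sum_product, ← sum_add_distrib]
  refine sum_congr rfl fun a _ => sum_congr rfl fun b _ => ?_
  rcases Int.even_or_odd a with ha | ha <;> rcases Int.even_or_odd b with hb | hb <;>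
    simp [ha, hb, Int.even_add, pow_add,
      Int.not_even_iff_odd.2, -Int.not_even_iff_odd]

theorem squareSum_even_add_odd_sq (N : ℕ) (x : R) :
    (squareSum Even N (x ^ 2) + squareSum Odd N (x ^ 2)) ^ 2 =
      ∑ p ∈ Icc (-N : ℤ) N ×ˢ Icc (-N : ℤ) N,
        x ^ (2 * p.1.natAbs ^ 2 + 2 * p.2.natAbs ^ 2) := by
  have h : squareSum Even N (x ^ 2) + squareSum Odd N (x ^ 2) =
      ∑ k ∈ Icc (-N : ℤ) N, x ^ (2 * k.natAbs ^ 2) := by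
    simp only [squareSum, ← pow_mul, ← Int.not_even_iff_odd]
    exact sum_filter_add_sum_filter_not _ _ _
  rw [h, sq, sum_mul_sum, sum_product]
  simp only [pow_add]

theorem X_pow_dvd_two_squares (N : ℕ) :
    (X : R⟦X⟧) ^ (N + 1) ∣ squareSum Even N X ^ 2 + squareSum Odd N X ^ 2 -
      (squareSum Even N (X ^ 2) + squareSum Odd N (X ^ 2)) ^ 2 := by
  rw [X_pow_dvd_iff]
  intro n hn
  rw [squareSum_even_sq_add_odd_sq, squareSum_even_add_odd_sq, map_sub, coeff_sum_X_pow,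
    coeff_sum_X_pow, card_two_squares (by omega), sub_self]

end TwoSquares

section EulerProduct

open PowerSeries

variable {R : Type*} [CommRing R]

theorem X_pow_dvd_prod_pow_eight (N : ℕ) :
    (X : R⟦X⟧) ^ (N + 1) ∣ (∏ i ∈ range N, (1 - (X : R⟦X⟧) ^ (i + 1))) ^ 8 -
      (∏ i ∈ range N, (1 - ((X : R⟦X⟧) ^ 4) ^ (i + 1))) ^ 2 *
      (squareSum Even N (X ^ 2) - squareSum Odd N (X ^ 2)) ^ 2 *
      ((squareSum Even N (X ^ 2) + squareSum Odd N (X ^ 2)) ^ 2 -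
        2 * (squareSum Even N X * squareSum Odd N X)) ^ 2 := by
  have h1 := pow_succ_dvd_gauss (X : R⟦X⟧) N
  have h2 : (X : R⟦X⟧) ^ (N + 1) ∣ _ :=
    (pow_dvd_pow_of_dvd (dvd_pow_self X two_ne_zero) _).trans
      (pow_succ_dvd_gauss ((X : R⟦X⟧) ^ 2) N)
  have h3 := X_pow_dvd_two_squares (R := R) N
  rw [← pow_mul] at h2
  norm_num only at h2
  generalize ∏ i ∈ range N, (1 - (X : R⟦X⟧) ^ (i + 1)) = Q at *
  generalize ∏ i ∈ range N, (1 - ((X : R⟦X⟧) ^ 2) ^ (i + 1)) = Q₂ at *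
  generalize ∏ i ∈ range N, (1 - ((X : R⟦X⟧) ^ 4) ^ (i + 1)) = Q₄ at *
  generalize squareSum Even N (X : R⟦X⟧) = e at *
  generalize squareSum Odd N (X : R⟦X⟧) = o at *
  generalize squareSum Even N ((X : R⟦X⟧) ^ 2) = e₂ at *
  generalize squareSum Odd N ((X : R⟦X⟧) ^ 2) = o₂ at *
  have h4 := h1.trans (sub_dvd_pow_sub_pow _ _ 4)
  have h5 := (h2.trans (sub_dvd_pow_sub_pow _ _ 2)).mul_right ((e - o) ^ 4)
  have h6 := h3.mul_right (Q₄ ^ 2 * (e₂ - o₂) ^ 2 *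
    ((e - o) ^ 2 + ((e₂ + o₂) ^ 2 - 2 * (e * o))))
  convert (h4.add h5).add h6 using 1
  ring

theorem coeff_prod_pow_eight {N k : ℕ} (h : 4 * k + 3 ≤ N) :
    coeff (4 * k + 3) ((∏ i ∈ range N, (1 - (X : R⟦X⟧) ^ (i + 1))) ^ 8) = 0 := by
  have hdvd := X_pow_dvd_iff.1 (X_pow_dvd_prod_pow_eight (R := R) N) (4 * k + 3) (by omega)
  rw [map_sub, sub_eq_zero] at hdvd
  rw [hdvd]
  have sq_even : ∀ k : ℤ, Even k → (k : ZMod 4) ^ 2 = 0 := by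
    rintro _ ⟨j, rfl⟩
    push_cast
    generalize (j : ZMod 4) = j
    revert j
    decide
  have sq_odd : ∀ k : ℤ, Odd k → (k : ZMod 4) ^ 2 = 1 := by
    rintro _ ⟨j, rfl⟩
    push_cast
    generalize (j : ZMod 4) = j
    revert j
    decide
  have hQ : ExponentsIn (0 : ZMod 4) (∏ i ∈ range N, (1 - ((X : R⟦X⟧) ^ 4) ^ (i + 1))) :=
    ExponentsIn.prod fun i _ => exponentsIn_one.sub (by
      rw [← pow_mul]
      exact exponentsIn_X_pow (by
        rw [Nat.cast_mul, show ((4 : ℕ) : ZMod 4) = 0 from rfl, zero_mul]))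
  have he : ExponentsIn (0 : ZMod 4) (squareSum Even N (X : R⟦X⟧)) := by
    simpa using exponentsIn_squareSum (R := R) (d := 4) (m := 1) (p := Even) (r := 0)
      (fun k hk => by simp [sq_even k hk]) N
  have ho : ExponentsIn (1 : ZMod 4) (squareSum Odd N (X : R⟦X⟧)) := by
    simpa using exponentsIn_squareSum (R := R) (d := 4) (m := 1) (p := Odd) (r := 1)
      (fun k hk => by simp [sq_odd k hk]) N
  have he₂ : ExponentsIn (0 : ZMod 4) (squareSum Even N ((X : R⟦X⟧) ^ 2)) :=
    exponentsIn_squareSum (fun k hk => by simp [sq_even k hk]) N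
  have ho₂ : ExponentsIn (2 : ZMod 4) (squareSum Odd N ((X : R⟦X⟧) ^ 2)) :=
    exponentsIn_squareSum (fun k hk => by simp [sq_odd k hk]) N
  generalize ∏ i ∈ range N, (1 - ((X : R⟦X⟧) ^ 4) ^ (i + 1)) = Q at *
  generalize squareSum Even N (X : R⟦X⟧) = e at *
  generalize squareSum Odd N (X : R⟦X⟧) = o at *
  generalize squareSum Even N ((X : R⟦X⟧) ^ 2) = e₂ at *
  generalize squareSum Odd N ((X : R⟦X⟧) ^ 2) = o₂ at *
  have ne_one : ((4 * k + 3 : ℕ) : ZMod 4) ≠ 1 := by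
    push_cast
    rw [show (4 : ZMod 4) = 0 from rfl, zero_mul, zero_add]
    decide
  have ne_zero : ((4 * k + 3 : ℕ) : ZMod 2) ≠ 0 := by
    push_cast
    rw [show (4 : ZMod 2) = 0 from rfl, zero_mul, zero_add]
    decide
  have two_dvd : 2 ∣ 4 := by norm_num
  have hQ' := hQ.castHom two_dvd
  have he' := he.castHom two_dvd
  have ho' := ho.castHom two_dvd
  have he₂' := he₂.castHom two_dvd
  have ho₂' : ExponentsIn (0 : ZMod 2) o₂ := ho₂.castHom two_dvd
  simp only [map_zero, map_one] at hQ' he' ho' he₂'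
  have h_sub := he₂'.sub ho₂'
  have h_add := he₂'.add ho₂'
  have h_even : ExponentsIn (0 : ZMod 2) (Q ^ 2 * (e₂ - o₂) ^ 2 *
      (((e₂ + o₂) ^ 2) ^ 2 + ((e * o) ^ 2 + (e * o) ^ 2 + ((e * o) ^ 2 + (e * o) ^ 2)))) := by
    have h_eo : ExponentsIn (0 : ZMod 2) ((e * o) ^ 2) := by
      rw [sq]
      exact (he'.mul ho').mul (he'.mul ho')
    simpa using ((hQ'.pow 2).mul (h_sub.pow 2)).mul
      ((((by simpa using h_add.pow 2 : ExponentsIn (0 : ZMod 2) _).pow 2)).add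
        (by simpa using (h_eo.add h_eo).add (h_eo.add h_eo)))
  have h_one : ExponentsIn (1 : ZMod 4) (Q ^ 2 * (e₂ ^ 2 - o₂ ^ 2) ^ 2 * (e * o)) := by
    have h1 : ExponentsIn (0 : ZMod 4) (e₂ ^ 2 - o₂ ^ 2) := (he₂.pow 2).sub (ho₂.pow 2)
    simpa using ((hQ.pow 2).mul (h1.pow 2)).mul (he.mul ho)
  have h_eq : Q ^ 2 * (e₂ - o₂) ^ 2 * ((e₂ + o₂) ^ 2 - 2 * (e * o)) ^ 2 =
      Q ^ 2 * (e₂ - o₂) ^ 2 *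
        (((e₂ + o₂) ^ 2) ^ 2 + ((e * o) ^ 2 + (e * o) ^ 2 + ((e * o) ^ 2 + (e * o) ^ 2))) -
      (4 : ℕ) • (Q ^ 2 * (e₂ ^ 2 - o₂ ^ 2) ^ 2 * (e * o)) := by
    rw [nsmul_eq_mul]
    push_cast
    ring
  rw [h_eq, map_sub, map_nsmul, h_even _ ne_zero, h_one _ ne_one, smul_zero, sub_zero]

theorem geom_sum_nine_eq (i : ℕ) :
    ∑ j ∈ range 9, (X : (ZMod 3)⟦X⟧) ^ ((i + 1) * j) = (1 - X ^ (i + 1)) ^ 8 := by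
  have hne : (1 : (ZMod 3)⟦X⟧) - X ^ (i + 1) ≠ 0 := fun h => by
    simpa using congrArg constantCoeff h
  have : CharP (ZMod 3)⟦X⟧ 3 := charP_of_injective_algebraMap (C_injective (R := ZMod 3)) 3
  apply mul_right_cancel₀ hne
  simp_rw [pow_mul]
  rw [geom_sum_mul_neg, ← pow_succ]
  simpa using (sub_pow_char_pow (p := 3) (n := 2) (1 : (ZMod 3)⟦X⟧) (X ^ (i + 1))).symm

open PowerSeries.WithPiTopology in
theorem exists_coeff_countRestricted_nine (n : ℕ) :
    ∃ N, n ≤ N ∧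
      coeff n (PowerSeries.mk fun n => (#(Nat.Partition.countRestricted n 9) : ZMod 3)) =
      coeff n ((∏ i ∈ range N, (1 - (X : (ZMod 3)⟦X⟧) ^ (i + 1))) ^ 8) := by
  let _ : TopologicalSpace (ZMod 3) := ⊥
  have _ : DiscreteTopology (ZMod 3) := ⟨rfl⟩
  have h := (Nat.Partition.hasProd_powerSeriesMk_card_countRestricted (ZMod 3)
    (m := 9) (by norm_num)).tendsto_prod_nat
  have h2 := ((continuous_coeff (ZMod 3) n).tendsto _).comp h
  rw [nhds_discrete, Filter.tendsto_pure] at h2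
  obtain ⟨N, hN, hNn⟩ := (h2.and (Filter.eventually_ge_atTop n)).exists
  refine ⟨N, hNn, ?_⟩
  rw [← hN, ← prod_pow]
  simp only [Function.comp_apply, geom_sum_nine_eq]

end EulerProduct

/-- For every nonnegative integer `k`, `b_9(4k+3) ≡ 0 (mod 3)`. -/
theorem b9_four_k_three_mod_three (k : ℕ) : 3 ∣ numRegular 9 (4 * k + 3) := by
  have h := congrArg (PowerSeries.coeff (4 * k + 3))
    (Nat.Partition.powerSeriesMk_card_restricted_eq_powerSeriesMk_card_countRestricted
      (ZMod 3) (m := 9) (by norm_num))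
  obtain ⟨N, hN, hcoeff⟩ := exists_coeff_countRestricted_nine (4 * k + 3)
  rw [hcoeff, coeff_prod_pow_eight hN, PowerSeries.coeff_mk] at h
  exact (ZMod.natCast_eq_zero_iff _ 3).1 h
end

section
/- For every nonnegative integer k, the number of 9-regular partitions of 16k+13 is divisible by 6, i.e., b_9(16k+13) ≡ 0 (mod 6). -/
open PowerSeries

/-- A function to `ℕ` all of whose fibers are finite. -/
def FiniteFibers {ι : Type*} (e : ι → ℕ) : Prop := ∀ n, (e ⁻¹' {n}).Finite

/-- The power series `∑ i, w i * X ^ e i`; it is meaningful when `e` has finite fibers. -/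
noncomputable def theta {ι R : Type*} [CommRing R] (e : ι → ℕ) (w : ι → R) : R⟦X⟧ :=
  PowerSeries.mk fun n => ∑ᶠ i ∈ e ⁻¹' {n}, w i

section Theta

variable {ι κ R : Type*} [CommRing R]

lemma Function.Injective.finiteFibers {e : ι → ℕ} (he : Function.Injective e) :
    FiniteFibers e := fun n =>
  (Set.finite_singleton n).preimage he.injOn

lemma FiniteFibers.add {e : ι → ℕ} {e' : κ → ℕ} (he : FiniteFibers e) (he' : FiniteFibers e') :
    FiniteFibers fun i : ι × κ => e i.1 + e' i.2 := by
  intro n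
  have h : ((fun i : ι × κ => e i.1 + e' i.2) ⁻¹' {n}) ⊆
      ⋃ a ∈ Set.Iic n, ⋃ b ∈ Set.Iic n, (e ⁻¹' {a}) ×ˢ (e' ⁻¹' {b}) := by
    rintro ⟨i, j⟩ hij
    simp only [Set.mem_preimage, Set.mem_singleton_iff] at hij
    simp only [Set.mem_iUnion, Set.mem_prod, Set.mem_preimage, Set.mem_singleton_iff, Set.mem_Iic]
    exact ⟨e i, by omega, e' j, by omega, rfl, rfl⟩
  exact ((Set.finite_Iic n).biUnion fun a _ => (Set.finite_Iic n).biUnion fun b _ =>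
    (he a).prod (he' b)).subset h

lemma FiniteFibers.comp {e : ι → ℕ} (he : FiniteFibers e) {f : κ → ι}
    (hf : Function.Injective f) : FiniteFibers (e ∘ f) := fun n => by
  rw [Set.preimage_comp]
  exact (he n).preimage hf.injOn

lemma FiniteFibers.mul_left {e : ι → ℕ} (he : FiniteFibers e) {m : ℕ} (hm : m ≠ 0) :
    FiniteFibers fun i => m * e i := fun n => by
  refine (he (n / m)).subset fun i hi => ?_
  simp only [Set.mem_preimage, Set.mem_singleton_iff] at hi ⊢
  rw [← hi, Nat.mul_div_cancel_left _ (Nat.pos_of_ne_zero hm)]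

lemma FiniteFibers.add_const {e : ι → ℕ} (he : FiniteFibers e) (m : ℕ) :
    FiniteFibers fun i => m + e i := fun n => by
  refine (he (n - m)).subset fun i hi => ?_
  simp only [Set.mem_preimage, Set.mem_singleton_iff] at hi ⊢
  omega

lemma coeff_theta {e : ι → ℕ} (he : FiniteFibers e) (w : ι → R) (n : ℕ) :
    (theta e w).coeff n = ∑ i ∈ (he n).toFinset, w i := by
  rw [theta, coeff_mk, finsum_mem_eq_finite_toFinset_sum]

lemma theta_comp_bijective {f : κ → ι} (hf : Function.Bijective f) (e : ι → ℕ) (w : ι → R) :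
    theta (e ∘ f) (w ∘ f) = theta e w := by
  ext n
  simp only [theta, coeff_mk]
  refine finsum_mem_eq_of_bijOn f ⟨fun i hi => hi, hf.1.injOn, fun i hi => ?_⟩ fun _ _ => rfl
  obtain ⟨j, rfl⟩ := hf.2 i
  exact ⟨j, hi, rfl⟩

lemma theta_sumElim {e : ι → ℕ} {e' : κ → ℕ} (he : FiniteFibers e) (he' : FiniteFibers e')
    (w : ι → R) (w' : κ → R) :
    theta (Sum.elim e e') (Sum.elim w w') = theta e w + theta e' w' := by
  ext n
  simp only [theta, coeff_mk, map_add]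
  have h : Sum.elim e e' ⁻¹' {n} = Sum.inl '' (e ⁻¹' {n}) ∪ Sum.inr '' (e' ⁻¹' {n}) := by
    ext (i | i) <;> simp
  rw [h, finsum_mem_union _ ((he n).image _) ((he' n).image _),
    finsum_mem_image Sum.inl_injective.injOn, finsum_mem_image Sum.inr_injective.injOn]
  · simp
  · rw [Set.disjoint_left]
    rintro _ ⟨i, -, rfl⟩ ⟨j, -, h⟩
    simp at h

lemma theta_mul {e : ι → ℕ} {e' : κ → ℕ} (he : FiniteFibers e) (he' : FiniteFibers e')
    (w : ι → R) (w' : κ → R) :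
    theta e w * theta e' w' =
      theta (fun i : ι × κ => e i.1 + e' i.2) (fun i => w i.1 * w' i.2) := by
  classical
  ext n
  rw [coeff_mul, coeff_theta (he.add he')]
  simp_rw [coeff_theta he, coeff_theta he', Finset.sum_mul_sum, ← Finset.sum_product']
  rw [Finset.sum_sigma']
  refine Finset.sum_bij (fun x _ => x.2) ?_ ?_ ?_ ?_
  · rintro ⟨⟨a, b⟩, i, j⟩ h
    simp_all
  · rintro ⟨⟨a, b⟩, i, j⟩ h ⟨⟨a', b'⟩, i', j'⟩ h' heq
    simp only [Prod.mk.injEq] at heq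
    obtain ⟨rfl, rfl⟩ := heq
    simp only [Finset.mem_sigma, Finset.mem_product, Set.Finite.mem_toFinset, Set.mem_preimage,
      Set.mem_singleton_iff] at h h'
    obtain ⟨-, rfl, rfl⟩ := h
    obtain ⟨-, rfl, rfl⟩ := h'
    rfl
  · rintro ⟨i, j⟩ h
    refine ⟨⟨(e i, e' j), i, j⟩, ?_, rfl⟩
    simp_all
  · simp

lemma expand_theta {e : ι → ℕ} (he : FiniteFibers e) (w : ι → R) {m : ℕ} (hm : m ≠ 0) :
    (theta e w).expand m hm = theta (fun i => m * e i) w := by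
  ext n
  rw [coeff_expand, coeff_theta (he.mul_left hm)]
  split_ifs with h
  · obtain ⟨k, rfl⟩ := h
    rw [Nat.mul_div_cancel_left _ (Nat.pos_of_ne_zero hm), coeff_theta he]
    refine Finset.sum_congr ?_ fun _ _ => rfl
    ext i
    simp [hm]
  · symm
    refine Finset.sum_eq_zero fun i hi => absurd ?_ h
    simp only [Set.Finite.mem_toFinset, Set.mem_preimage, Set.mem_singleton_iff] at hi
    exact ⟨e i, hi.symm⟩

lemma X_pow_mul_theta {e : ι → ℕ} (he : FiniteFibers e) (w : ι → R) (m : ℕ) :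
    X ^ m * theta e w = theta (fun i => m + e i) w := by
  ext n
  rw [coeff_X_pow_mul', coeff_theta (he.add_const m)]
  split_ifs with h
  · rw [coeff_theta he]
    refine Finset.sum_congr ?_ fun _ _ => rfl
    ext i
    simp only [Set.Finite.mem_toFinset, Set.mem_preimage, Set.mem_singleton_iff]
    omega
  · symm
    refine Finset.sum_eq_zero fun i hi => ?_
    simp only [Set.Finite.mem_toFinset, Set.mem_preimage, Set.mem_singleton_iff] at hi
    omega

lemma pentagonalSeries_eq_theta :
    pentagonalSeries R = theta pentagonal fun k => ((Int.negOnePow k : ℤ) : R) := by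
  ext n
  rw [coeff_theta pentagonal_injective.finiteFibers]
  by_cases h : n ∈ Set.range pentagonal
  · obtain ⟨k, rfl⟩ := h
    have : (pentagonal_injective.finiteFibers (pentagonal k)).toFinset = {k} := by
      ext i
      simp
    rw [coeff_pentagonalSeries_pentagonal, this, Finset.sum_singleton]
  · rw [coeff_pentagonalSeries_eq_zero R h]
    symm
    refine Finset.sum_eq_zero fun i hi => absurd ⟨i, ?_⟩ h
    simpa using hi

end Theta

section FixedPoints

variable {ι κ : Type*} {p : ℕ} [hp : Fact p.Prime]

lemma Finset.card_eq_card_filter_fixed [DecidableEq ι] (s : Finset ι) {g : ι → ι}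
    (hg : g^[p] = id) (hs : ∀ i ∈ s, g i ∈ s) :
    (s.card : ZMod p) = (s.filter fun i => g i = i).card := by
  rw [ZMod.natCast_eq_natCast_iff]
  let f : Function.End s := fun i => ⟨g i, hs i i.2⟩
  have hf : ∀ n (i : s), (((f ^ n) i : s) : ι) = g^[n] i := by
    intro n
    induction n with
    | zero => intro i; rfl
    | succ n ih =>
      intro i
      rw [pow_succ, Function.iterate_succ_apply]
      exact ih (f i)
  have hf1 : f ^ p ^ 1 = 1 := by
    funext i
    apply Subtype.ext
    rw [pow_one, hf, hg]
    rfl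
  have h := Equiv.Perm.card_fixedPoints_modEq hf1
  rw [Fintype.card_coe] at h
  convert h using 1
  rw [← Fintype.card_coe]
  refine Fintype.card_congr ⟨fun i => ⟨⟨i, (mem_filter.1 i.2).1⟩, Subtype.ext
    (mem_filter.1 i.2).2⟩, fun i => ⟨i, mem_filter.2 ⟨i.1.2, congrArg Subtype.val i.2⟩⟩,
    fun _ => rfl, fun _ => rfl⟩

lemma Finset.sum_eq_sum_filter_fixed [DecidableEq ι] (s : Finset ι) {g : ι → ι}
    (hg : g^[p] = id) (hs : ∀ i ∈ s, g i ∈ s) (w : ι → ZMod p) (hw : ∀ i, w (g i) = w i) :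
    ∑ i ∈ s, w i = ∑ i ∈ s with g i = i, w i := by
  rw [← sum_fiberwise s w w, ← sum_fiberwise (s.filter fun i => g i = i) w w]
  refine sum_congr rfl fun c _ => ?_
  have hc : ∀ t : Finset ι, ∑ i ∈ t with w i = c, w i = ((t.filter fun i => w i = c).card) * c := by
    intro t
    rw [sum_congr rfl fun i hi => (mem_filter.1 hi).2, sum_const, nsmul_eq_mul]
  rw [hc, hc, filter_comm, card_eq_card_filter_fixed _ hg]
  intro i hi
  rw [mem_filter] at hi ⊢
  exact ⟨hs i hi.1, (hw i).trans hi.2⟩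

/-- A theta series modulo `p` is unchanged when it is restricted to the fixed points of a
symmetry of order `p`. -/
lemma theta_eq_theta_fixedPoints {e : ι → ℕ} (he : FiniteFibers e) (w : ι → ZMod p) {g : ι → ι}
    (hg : g^[p] = id) (heg : ∀ i, e (g i) = e i) (hwg : ∀ i, w (g i) = w i) {f : κ → ι}
    (hf : Function.Injective f) (hfg : Set.range f = Function.fixedPoints g) :
    theta e w = theta (e ∘ f) (w ∘ f) := by
  classical
  ext n
  rw [coeff_theta he, coeff_theta (he.comp hf), Finset.sum_eq_sum_filter_fixed _ hg _ _ hwg]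
  · symm
    refine Finset.sum_bij (fun j _ => f j) (fun j hj => ?_) (fun _ _ _ _ h => hf h)
      (fun i hi => ?_) fun _ _ => rfl
    · have h : f j ∈ Function.fixedPoints g := hfg ▸ ⟨j, rfl⟩
      simp_all [Function.mem_fixedPoints, Function.IsFixedPt]
    · simp only [Finset.mem_filter, Set.Finite.mem_toFinset] at hi
      have h : i ∈ Set.range f := hfg ▸ hi.2
      obtain ⟨j, rfl⟩ := h
      exact ⟨j, by simpa using hi.1, rfl⟩
  · intro i hi
    simp_all

/-- A theta series vanishes when a symmetry of its exponents reverses the sign of its weights. -/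
lemma theta_eq_zero_of_neg {R : Type*} [CommRing R] (h2 : IsUnit (2 : R)) (e : ι → ℕ) (w : ι → R)
    {g : ι → ι} (hg : Function.Involutive g) (heg : ∀ i, e (g i) = e i)
    (hwg : ∀ i, w (g i) = -w i) : theta e w = 0 := by
  have h := theta_comp_bijective hg.bijective e w
  have h' : theta (e ∘ g) (w ∘ g) = -theta e w := by
    rw [show e ∘ g = e from funext heg, show w ∘ g = -w from funext hwg]
    ext n
    simp only [theta, coeff_mk, map_neg, Pi.neg_apply]
    simp only [finsum_neg_distrib]
  ext n
  have h3 : (2 : R) * (theta e w).coeff n = 0 := by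
    have := congrArg (coeff n) (h'.symm.trans h)
    rw [map_neg] at this
    linear_combination -this
  simpa using (h2.mul_right_eq_zero).1 h3

end FixedPoints

section RegularPartitions

open PowerSeries.WithPiTopology

lemma continuous_expand {R : Type*} [CommRing R] [TopologicalSpace R] {m : ℕ} (hm : m ≠ 0) :
    Continuous fun f : R⟦X⟧ => f.expand m hm := by
  rw [continuous_iff_continuousAt]
  intro f
  rw [ContinuousAt, tendsto_iff_coeff_tendsto]
  intro n
  simp only [coeff_expand]
  split_ifs
  · exact (continuous_coeff R _).tendsto f
  · exact tendsto_const_nhds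

/-- The generating function of `ℓ`-regular partitions is `∏ (1 - X ^ (ℓ i)) / ∏ (1 - X ^ i)`. -/
lemma mk_numRegular_mul_pentagonalSeries (R : Type*) [CommRing R] [NoZeroDivisors R] {ℓ : ℕ}
    (hℓ : ℓ ≠ 0) :
    (PowerSeries.mk fun n => (numRegular ℓ n : R)) * pentagonalSeries R =
      (pentagonalSeries R).expand ℓ hℓ := by
  let _ : TopologicalSpace R := ⊥
  have _ : DiscreteTopology R := ⟨rfl⟩
  have hR : (PowerSeries.mk fun n => (numRegular ℓ n : R)) =
      PowerSeries.mk fun n => ((Nat.Partition.countRestricted n ℓ).card : R) :=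
    Nat.Partition.powerSeriesMk_card_restricted_eq_powerSeriesMk_card_countRestricted R
      (Nat.pos_of_ne_zero hℓ)
  rw [hR]
  have h1 := (Nat.Partition.hasProd_powerSeriesMk_card_countRestricted R
    (Nat.pos_of_ne_zero hℓ)).mul (hasProd_one_sub_X_pow R)
  have h2 := (hasProd_one_sub_X_pow R).map (expand ℓ hℓ) (continuous_expand hℓ)
  have h3 : (fun i => (∑ j ∈ Finset.range ℓ, X ^ ((i + 1) * j)) * (1 - X ^ (i + 1))) =
      ⇑(expand (R := R) ℓ hℓ) ∘ fun i => 1 - X ^ (i + 1) := by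
    funext i
    simp only [pow_mul, geom_sum_mul_neg, Function.comp_apply, map_sub, map_one, map_pow, expand_X]
    rw [← pow_mul, ← pow_mul, mul_comm]
  rw [h3] at h1
  exact h1.unique h2

lemma PowerSeries.pow_eq_expand {p : ℕ} [hp : Fact p.Prime] (f : (ZMod p)⟦X⟧) (n : ℕ) :
    f ^ p ^ n = f.expand (p ^ n) (pow_ne_zero n hp.out.ne_zero) := by
  have h := MvPowerSeries.map_iterateFrobenius_expand (σ := Unit) p hp.out.ne_zero f n
  rw [iterateFrobenius_eq_pow, ZMod.frobenius_zmod, ← RingHom.one_def, one_pow] at h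
  exact h.symm.trans (congrFun (congrArg DFunLike.coe MvPowerSeries.map_id) _)

end RegularPartitions

section ModThree

/-- The exponents of the generating function of `3`-cores,
`3 * core (s, t) + 1` being the norm of `1 + 3 * (s + t * ω)` in the Eisenstein integers. -/
def core (i : ℤ × ℤ) : ℕ :=
  (3 * (i.1 ^ 2 - i.1 * i.2 + i.2 ^ 2) + 2 * i.1 - i.2).toNat

lemma natCast_core (s t : ℤ) :
    (core (s, t) : ℤ) = 3 * (s ^ 2 - s * t + t ^ 2) + 2 * s - t := by
  refine Int.toNat_of_nonneg ?_
  show 0 ≤ 3 * (s ^ 2 - s * t + t ^ 2) + 2 * s - t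
  by_contra! h
  nlinarith [sq_nonneg (2 + 6 * s - 3 * t), sq_nonneg t]

lemma finiteFibers_core : FiniteFibers core := by
  intro n
  refine ((Set.finite_Icc (-(n + 2) : ℤ) (n + 2)).prod
    (Set.finite_Icc (-(n + 2) : ℤ) (n + 2))).subset ?_
  rintro ⟨s, t⟩ h
  have h1 : (core (s, t) : ℤ) = n := by exact_mod_cast h
  rw [natCast_core] at h1
  simp only [Set.mem_prod, Set.mem_Icc]
  have hs : 3 * (1 + 3 * s) ^ 2 ≤ 12 * (n : ℤ) + 4 := by
    nlinarith [sq_nonneg (6 * t - (1 + 3 * s))]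
  have ht : 27 * t ^ 2 ≤ 12 * (n : ℤ) + 4 := by
    nlinarith [sq_nonneg (2 + 6 * s - 3 * t)]
  refine ⟨⟨?_, ?_⟩, ?_, ?_⟩ <;> nlinarith

lemma core_ne (i : ℤ × ℤ) (k : ℕ) : core i ≠ 16 * k + 13 := by
  obtain ⟨s, t⟩ := i
  intro h
  have h1 : (core (s, t) : ℤ) = 16 * k + 13 := by exact_mod_cast h
  rw [natCast_core] at h1
  have even_of_norm : ∀ u v c : ℤ, u ^ 2 - u * v + v ^ 2 = 2 * c → Even u ∧ Even v := by
    intro u v c h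
    have h2 : Even (u ^ 2 - u * v + v ^ 2) := ⟨c, by rw [h]; ring⟩
    simp only [Int.even_add, Int.even_sub, Int.even_mul, Int.even_pow] at h2
    tauto
  obtain ⟨⟨u, hu⟩, v, hv⟩ := even_of_norm (1 + 3 * s) (3 * t) (4 * (6 * k + 5))
    (by linear_combination 3 * h1)
  have h2 : u ^ 2 - u * v + v ^ 2 = 2 * (6 * k + 5) := by
    have h3 : (1 + 3 * s) ^ 2 - (1 + 3 * s) * (3 * t) + (3 * t) ^ 2 = 8 * (6 * k + 5) := by
      linear_combination 3 * h1
    rw [hu, hv] at h3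
    linarith
  obtain ⟨⟨u, rfl⟩, v, rfl⟩ := even_of_norm u v _ h2
  have h3 : 2 * (u ^ 2 - u * v + v ^ 2) = 6 * k + 5 := by linarith
  omega

/-- The triples whose first entry minus the sum of the others is `r` modulo `3`. -/
def residueMap (r : ℤ) (i : ℤ × ℤ × ℤ) : ℤ × ℤ × ℤ :=
  (i.2.1 + i.2.2 + 3 * i.1 + r, i.2.1, i.2.2)

lemma residueMap_injective (r : ℤ) : Function.Injective (residueMap r) := by
  rintro ⟨m, s, t⟩ ⟨m', s', t'⟩ h
  simp only [residueMap, Prod.mk.injEq] at h ⊢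
  omega

lemma bijective_residueMap : Function.Bijective
    (Sum.elim (residueMap 0) (Sum.elim (residueMap 1) (residueMap (-1)))) := by
  constructor
  · rintro (⟨m, s, t⟩ | ⟨m, s, t⟩ | ⟨m, s, t⟩) (⟨m', s', t'⟩ | ⟨m', s', t'⟩ | ⟨m', s', t'⟩) h <;>
    simp only [Sum.elim_inl, Sum.elim_inr, residueMap, Prod.mk.injEq, Sum.inl.injEq,
      Sum.inr.injEq] at h ⊢ <;> omega
  · rintro ⟨k, s, t⟩
    have h : (k - s - t) % 3 = 0 ∨ (k - s - t) % 3 = 1 ∨ (k - s - t) % 3 = 2 := by omega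
    rcases h with h | h | h
    · refine ⟨.inl ((k - s - t) / 3, s, t), ?_⟩
      simp only [Sum.elim_inl, residueMap, Prod.mk.injEq, and_true]
      omega
    · refine ⟨.inr (.inl ((k - s - t) / 3, s, t)), ?_⟩
      simp only [Sum.elim_inl, Sum.elim_inr, residueMap, Prod.mk.injEq, and_true]
      omega
    · refine ⟨.inr (.inr ((k - s - t) / 3 + 1, s, t)), ?_⟩
      simp only [Sum.elim_inr, residueMap, Prod.mk.injEq, and_true]
      omega

/-- The exponents of the product of the pentagonal series and the theta series of `core`. -/
def pentagonalCore (i : ℤ × ℤ × ℤ) : ℕ := pentagonal i.1 + core i.2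

lemma finiteFibers_pentagonalCore : FiniteFibers pentagonalCore :=
  pentagonal_injective.finiteFibers.add finiteFibers_core

lemma pentagonalCore_eq_iff {k s t k' s' t' : ℤ} :
    pentagonalCore (k, s, t) = pentagonalCore (k', s', t') ↔
      k * (3 * k - 1) + 2 * (3 * (s ^ 2 - s * t + t ^ 2) + 2 * s - t) =
      k' * (3 * k' - 1) + 2 * (3 * (s' ^ 2 - s' * t' + t' ^ 2) + 2 * s' - t') := by
  have h := two_mul_natCast_pentagonal k
  have h' := two_mul_natCast_pentagonal k'
  rw [← natCast_core, ← natCast_core, ← h, ← h']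
  simp only [pentagonalCore]
  omega

/-- The weights of the pentagonal series, as a function on triples. -/
def sign (i : ℤ × ℤ × ℤ) : ZMod 3 := ((Int.negOnePow i.1 : ℤ) : ZMod 3)

lemma sign_eq {k k' : ℤ} (x x' : ℤ × ℤ) (h : Even (k - k')) : sign (k, x) = sign (k', x') := by
  simp only [sign]
  rw [(Int.negOnePow_eq_iff k k').2 h]

lemma sign_eq_neg {k k' : ℤ} (x x' : ℤ × ℤ) (h : Odd (k - k')) :
    sign (k, x) = -sign (k', x') := by
  have h1 : k = k' + (k - k') := by ring
  simp only [sign]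
  rw [h1, Int.negOnePow_add, Int.negOnePow_odd _ h]
  simp

lemma theta_residueMap_zero :
    theta (pentagonalCore ∘ residueMap 0) (sign ∘ residueMap 0) =
      (pentagonalSeries (ZMod 3)).expand 9 (by norm_num) := by
  rw [theta_eq_theta_fixedPoints (finiteFibers_pentagonalCore.comp (residueMap_injective 0)) _
    (g := fun i => (i.1 + i.2.2, -2 * i.1 - i.2.2, -2 * i.1 - i.2.1 - i.2.2))
    (f := fun m : ℤ => (m, -2 * m, 0)), pentagonalSeries_eq_theta,
    expand_theta pentagonal_injective.finiteFibers]
  · congr 1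
    · funext m
      have h1 := natCast_core (-2 * m) 0
      have h2 := two_mul_natCast_pentagonal m
      have h3 : residueMap 0 (m, -2 * m, 0) = (m, -2 * m, 0) := by
        simp only [residueMap, Prod.mk.injEq, and_true]
        ring
      simp only [Function.comp_apply, h3, pentagonalCore]
      zify
      rw [h1]
      linear_combination -4 * h2
    · funext m
      simp only [Function.comp_apply, residueMap, sign]
      congr 3
      ring
  · funext ⟨m, s, t⟩
    simp only [Function.iterate_succ, Function.iterate_zero, Function.comp_apply, id,
      Prod.mk.injEq]
    refine ⟨?_, ?_, ?_⟩ <;> ring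
  · rintro ⟨m, s, t⟩
    simp only [Function.comp_apply, residueMap, pentagonalCore_eq_iff]
    ring
  · rintro ⟨m, s, t⟩
    exact sign_eq _ _ ⟨-2 * m - s, by ring⟩
  · intro m m' h
    exact congrArg Prod.fst h
  · ext ⟨m, s, t⟩
    simp only [Set.mem_range, Function.mem_fixedPoints, Function.IsFixedPt, Prod.mk.injEq]
    constructor
    · rintro ⟨m', rfl, rfl, rfl⟩
      omega
    · intro h
      exact ⟨m, by omega⟩

lemma theta_residueMap_one :
    theta (pentagonalCore ∘ residueMap 1) (sign ∘ residueMap 1) = 0 := by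
  refine theta_eq_zero_of_neg (by decide) _ _
    (g := fun i => (i.1, -i.2.1 - 2 * i.1 - 1, i.2.2)) ?_ ?_ ?_
  · rintro ⟨m, s, t⟩
    simp only [Prod.mk.injEq, true_and, and_true]
    ring
  · rintro ⟨m, s, t⟩
    simp only [Function.comp_apply, residueMap, pentagonalCore_eq_iff]
    ring
  · rintro ⟨m, s, t⟩
    exact sign_eq_neg _ _ ⟨-s - m - 1, by ring⟩

lemma theta_residueMap_neg_one :
    theta (pentagonalCore ∘ residueMap (-1)) (sign ∘ residueMap (-1)) = 0 := by
  refine theta_eq_zero_of_neg (by decide) _ _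
    (g := fun i => (1 - i.1, i.2.1 + 2 * i.1 - 1, i.2.2 + 2 * i.1 - 1)) ?_ ?_ ?_
  · rintro ⟨m, s, t⟩
    simp only [Prod.mk.injEq]
    refine ⟨?_, ?_, ?_⟩ <;> ring
  · rintro ⟨m, s, t⟩
    simp only [Function.comp_apply, residueMap, pentagonalCore_eq_iff]
    ring
  · rintro ⟨m, s, t⟩
    exact sign_eq_neg _ _ ⟨-m, by ring⟩

lemma pentagonalSeries_mul_theta_core :
    pentagonalSeries (ZMod 3) * theta core (fun _ => 1) =
      (pentagonalSeries (ZMod 3)).expand 9 (by norm_num) := by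
  have h : pentagonalSeries (ZMod 3) * theta core (fun _ => 1) = theta pentagonalCore sign := by
    rw [pentagonalSeries_eq_theta, theta_mul pentagonal_injective.finiteFibers finiteFibers_core]
    simp only [mul_one]
    rfl
  have hf := finiteFibers_pentagonalCore
  have h1 := hf.comp (residueMap_injective 1)
  have h2 := hf.comp (residueMap_injective (-1))
  rw [h, ← theta_comp_bijective bijective_residueMap]
  simp only [Sum.comp_elim]
  rw [theta_sumElim (hf.comp (residueMap_injective 0)), theta_sumElim h1 h2,
    theta_residueMap_zero, theta_residueMap_one, theta_residueMap_neg_one, add_zero, add_zero]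
  rw [← Sum.comp_elim]
  exact hf.comp (bijective_residueMap.1.comp Sum.inr_injective)

lemma pentagonalSeries_ne_zero (R : Type*) [CommRing R] [Nontrivial R] :
    pentagonalSeries R ≠ 0 := by
  intro h
  have h1 := coeff_pentagonalSeries_pentagonal R 0
  rw [h] at h1
  simp at h1

lemma three_dvd_numRegular (k : ℕ) : 3 ∣ numRegular 9 (16 * k + 13) := by
  have h := mk_numRegular_mul_pentagonalSeries (ZMod 3) (ℓ := 9) (by norm_num)
  rw [← pentagonalSeries_mul_theta_core, mul_comm] at h
  have h1 := congrArg (coeff (16 * k + 13))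
    (mul_left_cancel₀ (pentagonalSeries_ne_zero (ZMod 3)) h)
  rw [coeff_mk, coeff_theta finiteFibers_core, Finset.sum_eq_zero] at h1
  · exact (ZMod.natCast_eq_zero_iff _ _).1 h1
  · intro i hi
    exact absurd (by simpa using hi) (core_ne i k)

end ModThree

section ModTwo

/-- The triangular numbers, indexed by the integers through `j ↦ j * (2 * j + 1)`. -/
def triangular (j : ℤ) : ℕ := (j * (2 * j + 1)).toNat

lemma natCast_triangular (j : ℤ) : (triangular j : ℤ) = j * (2 * j + 1) := by
  refine Int.toNat_of_nonneg ?_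
  rcases le_or_gt 0 j with h | h <;> nlinarith

lemma triangular_injective : Function.Injective triangular := by
  intro i j h
  have h1 := natCast_triangular i
  rw [h, natCast_triangular] at h1
  have h2 : (i - j) * (2 * (i + j) + 1) = 0 := by linear_combination -h1
  rcases mul_eq_zero.1 h2 with h3 | h3 <;> omega

/-- The generating function modulo `2` of the triangular numbers. -/
noncomputable def triangularSeries : (ZMod 2)⟦X⟧ := theta triangular fun _ => 1

lemma pentagonalSeries_eq_theta_one :
    pentagonalSeries (ZMod 2) = theta pentagonal fun _ => 1 := by
  rw [pentagonalSeries_eq_theta]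
  congr 1
  funext k
  rcases Int.even_or_odd k with h | h
  · simp [Int.negOnePow_even _ h]
  · simp [Int.negOnePow_odd _ h]

/-- The `3`-dissection of the triangular series. -/
lemma triangularSeries_eq :
    triangularSeries = (pentagonalSeries (ZMod 2)).expand 3 (by norm_num) +
      X ^ 1 * triangularSeries.expand 9 (by norm_num) := by
  have ht := triangular_injective.finiteFibers
  have hp := pentagonal_injective.finiteFibers
  have h9 := ht.mul_left (m := 9) (by norm_num)
  rw [triangularSeries, pentagonalSeries_eq_theta_one, expand_theta hp, expand_theta ht,
    X_pow_mul_theta h9, ← theta_sumElim (hp.mul_left (by norm_num)) (h9.add_const 1)]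
  rw [← theta_comp_bijective (f := Sum.elim
    (fun k : ℤ => if k % 2 = 0 then -3 * (k / 2) else 3 * (k / 2) + 1) fun l : ℤ => -3 * l - 1)]
  · congr 1
    · funext x
      rcases x with k | l
      · have h1 := two_mul_natCast_pentagonal k
        simp only [Function.comp_apply, Sum.elim_inl]
        zify
        rw [natCast_triangular]
        have h2 : k = 2 * (k / 2) ∨ k = 2 * (k / 2) + 1 := by omega
        generalize k / 2 = i at h2
        rcases h2 with rfl | rfl
        · rw [if_pos (by omega)]
          linarith
        · rw [if_neg (by omega)]
          linarith
      · simp only [Function.comp_apply, Sum.elim_inr]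
        zify
        rw [natCast_triangular, natCast_triangular]
        ring
    · funext x
      rcases x with k | l <;> rfl
  · constructor
    · rintro (k | l) (k' | l') h <;> simp only [Sum.elim_inl, Sum.elim_inr, Sum.inl.injEq,
        Sum.inr.injEq, reduceCtorEq] at h ⊢ <;> omega
    · intro j
      have h : j % 3 = 0 ∨ j % 3 = 1 ∨ j % 3 = 2 := by omega
      rcases h with h | h | h
      · refine ⟨.inl (-2 * (j / 3)), ?_⟩
        simp only [Sum.elim_inl]
        split_ifs <;> omega
      · refine ⟨.inl (2 * (j / 3) + 1), ?_⟩
        simp only [Sum.elim_inl]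
        split_ifs <;> omega
      · refine ⟨.inr (-(j / 3) - 1), ?_⟩
        simp only [Sum.elim_inr]
        omega

/-- The involution on the solutions of `x ^ 2 + 3 * y ^ 2 = 8 * n + 4` in odd integers given by
multiplication by a sixth root of unity, up to conjugation. -/
def eisensteinInvolution (x : ℤ × ℤ) : ℤ × ℤ :=
  if (x.1 + x.2) % 2 = 0 then ((3 * x.2 - x.1) / 2, (x.1 + x.2) / 2)
  else ((x.1 - 3 * x.2 - 1) / 2, -((x.1 + x.2 + 1) / 2))

lemma eisensteinInvolution_eq (i j : ℤ) :
    ∃ k, i = 2 * k - j ∧ eisensteinInvolution (i, j) = (2 * j - k, k) ∨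
      i = 2 * k - 1 - j ∧ eisensteinInvolution (i, j) = (k - 1 - 2 * j, -k) := by
  simp only [eisensteinInvolution]
  split_ifs with h
  · refine ⟨(i + j) / 2, .inl ⟨by omega, ?_⟩⟩
    rw [Prod.mk.injEq]
    omega
  · refine ⟨(i + j + 1) / 2, .inr ⟨by omega, ?_⟩⟩
    rw [Prod.mk.injEq]
    omega

lemma eisensteinInvolution_involutive : Function.Involutive eisensteinInvolution := by
  rintro ⟨i, j⟩
  simp only [eisensteinInvolution]
  split_ifs <;> simp only [Prod.mk.injEq] at * <;> omega

/-- The `2`-dissection of the product of two triangular series. -/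
lemma triangularSeries_mul_expand_three :
    triangularSeries * triangularSeries.expand 3 (by norm_num) =
      triangularSeries.expand 4 (by norm_num) +
        X ^ 1 * triangularSeries.expand 12 (by norm_num) := by
  have ht := triangular_injective.finiteFibers
  have h3 := ht.mul_left (m := 3) (by norm_num)
  have h12 := ht.mul_left (m := 12) (by norm_num)
  simp only [triangularSeries]
  rw [expand_theta ht, expand_theta ht, expand_theta ht, X_pow_mul_theta h12,
    ← theta_sumElim (ht.mul_left (by norm_num)) (h12.add_const 1), theta_mul ht h3,
    theta_eq_theta_fixedPoints (ht.add h3) _ (g := eisensteinInvolution)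
      (f := Sum.elim (fun j : ℤ => (j, j)) fun j : ℤ => (-3 * j - 1, j))]
  · congr 1
    · funext x
      rcases x with j | j <;> simp only [Function.comp_apply, Sum.elim_inl, Sum.elim_inr] <;> zify
      · ring
      · rw [natCast_triangular, natCast_triangular]
        ring
    · funext x
      rcases x with j | j <;> simp
  · exact eisensteinInvolution_involutive.comp_self
  · rintro ⟨i, j⟩
    zify
    simp only [natCast_triangular]
    obtain ⟨k, ⟨rfl, h⟩ | ⟨rfl, h⟩⟩ := eisensteinInvolution_eq i j <;> rw [h] <;> ring
  · exact fun _ => rfl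
  · rintro (i | i) (j | j) h <;> simp only [Sum.elim_inl, Sum.elim_inr, Sum.inl.injEq,
        Sum.inr.injEq, reduceCtorEq, Prod.mk.injEq] at h ⊢ <;> omega
  · ext ⟨i, j⟩
    simp only [Set.mem_range, Sum.exists, Sum.elim_inl, Sum.elim_inr, Function.mem_fixedPoints,
      Function.IsFixedPt, eisensteinInvolution, Prod.mk.injEq]
    constructor
    · rintro (⟨k, rfl, rfl⟩ | ⟨k, rfl, rfl⟩) <;> split_ifs <;> rw [Prod.mk.injEq] <;> omega
    · intro h
      split_ifs at h <;> rw [Prod.mk.injEq] at h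
      · exact .inl ⟨j, by omega⟩
      · exact .inr ⟨j, by omega⟩

lemma PowerSeries.two_eq_zero : (2 : (ZMod 2)⟦X⟧) = 0 := by
  have h : (C (2 : ZMod 2) : (ZMod 2)⟦X⟧) = 2 := map_ofNat _ 2
  rw [← h, show (2 : ZMod 2) = 0 from rfl, map_zero]

lemma PowerSeries.expand_four (f : (ZMod 2)⟦X⟧) : f.expand 4 (by norm_num) = f ^ 4 :=
  (pow_eq_expand f 2).symm

lemma triangularSeries_mul_expand_three' :
    triangularSeries * triangularSeries.expand 3 (by norm_num) =
      triangularSeries ^ 4 + X * triangularSeries.expand 3 (by norm_num) ^ 4 := by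
  rw [triangularSeries_mul_expand_three, expand_four, pow_one, ← expand_four (expand _ _ _),
    ← expand_mul]

lemma PowerSeries.expand_injective {R : Type*} [CommRing R] {m : ℕ} (hm : m ≠ 0) :
    Function.Injective (expand (R := R) m hm) := by
  intro f g h
  ext n
  rw [← coeff_expand_mul m hm f, h, coeff_expand_mul]

lemma triangularSeries_eq_pow_three : triangularSeries = pentagonalSeries (ZMod 2) ^ 3 := by
  have h0 := PowerSeries.two_eq_zero
  have h1 := triangularSeries_eq
  have h2 := triangularSeries_mul_expand_three'
  have h3 := congrArg (expand 3 (by norm_num)) h2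
  simp only [map_mul, map_add, map_pow, expand_X, ← expand_mul, Nat.reduceMul] at h3
  have hb : (pentagonalSeries (ZMod 2)).expand 3 (by norm_num) ≠ 0 := by
    rw [Ne, map_eq_zero_iff _ (expand_injective _)]
    exact pentagonalSeries_ne_zero _
  apply expand_injective (m := 3) (by norm_num)
  apply mul_left_cancel₀ hb
  rw [map_pow]
  generalize (pentagonalSeries (ZMod 2)).expand 3 _ = b at *
  generalize triangularSeries.expand 3 _ = P₃ at *
  generalize triangularSeries.expand 9 _ = P₉ at *
  generalize triangularSeries = P at *
  subst h1
  linear_combination h2 - X * h3 +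
    (2 * b ^ 3 * X * P₉ + 3 * b ^ 2 * X ^ 2 * P₉ ^ 2 + 2 * b * X ^ 3 * P₉ ^ 3) * h0

lemma pentagonalSeries_pow_three :
    pentagonalSeries (ZMod 2) ^ 3 = (pentagonalSeries (ZMod 2)).expand 3 (by norm_num) +
      X * (pentagonalSeries (ZMod 2)).expand 9 (by norm_num) ^ 3 := by
  have h := triangularSeries_eq
  rw [triangularSeries_eq_pow_three, pow_one, map_pow] at h
  exact h

lemma pentagonalSeries_pow_three_mul :
    pentagonalSeries (ZMod 2) ^ 3 * (pentagonalSeries (ZMod 2)).expand 3 (by norm_num) ^ 3 =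
      pentagonalSeries (ZMod 2) ^ 12 +
        X * (pentagonalSeries (ZMod 2)).expand 3 (by norm_num) ^ 12 := by
  have h := triangularSeries_mul_expand_three'
  simp only [triangularSeries_eq_pow_three, map_pow, ← pow_mul, Nat.reduceMul] at h
  exact h

lemma sq_add_X_pow_mul (n : ℕ) (f g : (ZMod 2)⟦X⟧) :
    (f + X ^ n * g) ^ 2 = f ^ 2 + X ^ (2 * n) * g ^ 2 := by
  linear_combination f * X ^ n * g * two_eq_zero

/-- The dissection of the generating function of `9`-regular partitions modulo `2`. -/
lemma exists_mk_numRegular_nine_eq : ∃ f₁ f₂ f₃ f₄ : (ZMod 2)⟦X⟧,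
    (PowerSeries.mk fun n => (numRegular 9 n : ZMod 2)) =
      f₁ ^ 2 ^ 1 + X ^ 1 * f₂ ^ 2 ^ 3 + X ^ 5 * f₃ ^ 2 ^ 4 + X ^ 3 * f₄ ^ 2 ^ 2 := by
  have h0 := PowerSeries.two_eq_zero
  have hB := mk_numRegular_mul_pentagonalSeries (ZMod 2) (ℓ := 9) (by norm_num)
  have h1 := pentagonalSeries_pow_three
  have h2 := pentagonalSeries_pow_three_mul
  have h3 := congrArg (expand 3 (by norm_num)) h2
  simp only [map_mul, map_add, map_pow, expand_X, ← expand_mul, Nat.reduceMul] at h3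
  have hinv : ∀ f : (ZMod 2)⟦X⟧, f.constantCoeff = 1 → ∃ g, f * g = 1 := fun f hf =>
    ⟨f⁻¹, PowerSeries.mul_inv_cancel _ (by simp [hf])⟩
  have ha : (pentagonalSeries (ZMod 2)).constantCoeff = 1 := by
    simpa [pentagonal_def] using coeff_pentagonalSeries_pentagonal (ZMod 2) 0
  obtain ⟨u, hu⟩ := hinv _ ha
  obtain ⟨v, hv⟩ := hinv ((pentagonalSeries (ZMod 2)).expand 3 (by norm_num)) (by simpa using ha)
  obtain ⟨w, hw⟩ := hinv ((pentagonalSeries (ZMod 2)).expand 9 (by norm_num)) (by simpa using ha)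
  generalize (PowerSeries.mk fun n => (numRegular 9 n : ZMod 2)) = B at *
  generalize (pentagonalSeries (ZMod 2)).expand 3 _ = b at *
  generalize (pentagonalSeries (ZMod 2)).expand 9 _ = c at *
  generalize pentagonalSeries (ZMod 2) = a at *
  have hac : a ^ 3 * c ^ 3 * b ^ 2 = b ^ 12 + X * (a ^ 6 * c ^ 6) := by
    have h4 : a ^ 6 = b ^ 2 + X ^ 2 * c ^ 6 := by
      linear_combination (a ^ 3 + b + X * c ^ 3) * h1 + b * X * c ^ 3 * h0
    linear_combination c ^ 3 * b ^ 2 * h1 + h3 - X * c ^ 6 * h4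
  have hu2 : a ^ 2 * u ^ 2 = 1 := by rw [← mul_pow, hu, one_pow]
  have hv2 : b ^ 2 * v ^ 2 = 1 := by rw [← mul_pow, hv, one_pow]
  have hw2 : c ^ 2 * w ^ 2 = 1 := by rw [← mul_pow, hw, one_pow]
  have hac' : a * c = b ^ 10 * u ^ 2 * w ^ 2 + X * (a ^ 4 * c ^ 4 * v ^ 2) := by
    linear_combination u ^ 2 * v ^ 2 * w ^ 2 * hac
      - a * c * (hu2 * (b ^ 2 * v ^ 2 * c ^ 2 * w ^ 2) + hv2 * (c ^ 2 * w ^ 2) + hw2)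
      + b ^ 10 * u ^ 2 * w ^ 2 * hv2 + X * a ^ 4 * c ^ 4 * v ^ 2 * (hu2 * (c ^ 2 * w ^ 2) + hw2)
  have hab' : a * b = a ^ 10 * v ^ 2 + X * (b ^ 10 * u ^ 2) := by
    linear_combination u ^ 2 * v ^ 2 * h2 - a * b * (hu2 * (b ^ 2 * v ^ 2) + hv2)
      + a ^ 10 * v ^ 2 * hu2 + X * b ^ 10 * u ^ 2 * hv2
  have e1 : B = (b ^ 5 * u ^ 2 * w) ^ 2 + X ^ 1 * (a * c ^ 2 * v) ^ 2 := by
    linear_combination u * hB - B * hu + u ^ 2 * hac' - c * u * hu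
      + X * a ^ 2 * c ^ 4 * v ^ 2 * hu2
  have e2 : a * c ^ 2 * v = (a ^ 5 * c * v ^ 2) ^ 2 + X ^ 1 * (b ^ 4 * c * u) ^ 2 := by
    linear_combination c ^ 2 * v ^ 2 * hab' - a * c ^ 2 * v * hv + X * b ^ 8 * u ^ 2 * c ^ 2 * hv2
  have e3 : a ^ 5 * c * v ^ 2 = (b ^ 4 * a * w) ^ 2 + X ^ 1 * (a ^ 2 * c * v) ^ 4 := by
    linear_combination a ^ 4 * v ^ 2 * hac' + a ^ 2 * b ^ 8 * w ^ 2 * (hu2 * (b ^ 2 * v ^ 2) + hv2)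
  refine ⟨b ^ 5 * u ^ 2 * w, b ^ 4 * a * w, a ^ 2 * c * v, b ^ 4 * c * u, ?_⟩
  rw [e1, e2, sq_add_X_pow_mul, e3, sq_add_X_pow_mul, sq_add_X_pow_mul]
  ring

lemma coeff_X_pow_mul_pow_eq_zero {m i n : ℕ} (f : (ZMod 2)⟦X⟧) (h : n % 2 ^ m ≠ i % 2 ^ m) :
    (X ^ i * f ^ 2 ^ m).coeff n = 0 := by
  rw [coeff_X_pow_mul', pow_eq_expand]
  split_ifs with hi
  · refine coeff_expand_of_not_dvd _ _ _ fun hd => h ?_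
    exact ((Nat.modEq_iff_dvd' hi).2 hd).symm
  · rfl

lemma two_dvd_numRegular (k : ℕ) : 2 ∣ numRegular 9 (16 * k + 13) := by
  obtain ⟨f₁, f₂, f₃, f₄, h⟩ := exists_mk_numRegular_nine_eq
  have h1 := congrArg (coeff (16 * k + 13)) h
  rw [← one_mul (f₁ ^ _), ← pow_zero X, coeff_mk, map_add, map_add, map_add] at h1
  rw [coeff_X_pow_mul_pow_eq_zero f₁ (by omega), coeff_X_pow_mul_pow_eq_zero f₂ (by omega),
    coeff_X_pow_mul_pow_eq_zero f₃ (by omega), coeff_X_pow_mul_pow_eq_zero f₄ (by omega)] at h1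
  exact (ZMod.natCast_eq_zero_iff _ _).1 (by simpa using h1)

end ModTwo

/-- For every nonnegative integer `k`, `b_9(16k+13) ≡ 0 (mod 6)`. -/
theorem b9_sixteen_k_thirteen_mod_six (k : ℕ) : 6 ∣ numRegular 9 (16 * k + 13) :=
  Nat.Coprime.mul_dvd_of_dvd_of_dvd (m := 2) (n := 3) (by norm_num) (two_dvd_numRegular k)
    (three_dvd_numRegular k)
end

section
/- For every positive integer a and every nonnegative integer n, b_9(4^a · n + (10 · 4^{a-1} − 1)/3) ≡ 0 (mod 3). (Note that 10 · 4^{a-1} − 1 is divisible by 3 for all a ≥ 1, so the argument is a nonnegative integer.) -/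
open Filter Topology PowerSeries
open scoped PowerSeries.WithPiTopology

namespace RegularPartition

variable {R : Type*} [CommRing R] {ι κ : Type*}

/-- The generating series `∑ i, X ^ g i` of a family `g` of nonnegative integers with finite
fibres. -/
noncomputable def theta (R : Type*) [CommRing R] (g : ι → ℤ) : R⟦X⟧ :=
  .mk fun n ↦ (Nat.card {i // g i = n} : R)

/-- The fibres of `g` over the natural numbers are finite. -/
def FiniteFibres (g : ι → ℤ) : Prop :=
  ∀ n : ℕ, Finite {i // g i = n}

theorem theta_comp_equiv (e : κ ≃ ι) (g : ι → ℤ) : theta R (fun k ↦ g (e k)) = theta R g := by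
  ext n
  simp only [theta, coeff_mk]
  rw [Nat.card_congr (e.subtypeEquiv (p := fun k ↦ g (e k) = n) (q := fun i ↦ g i = n)
    fun _ ↦ Iff.rfl)]

theorem theta_sumElim {g : ι → ℤ} {h : κ → ℤ} (hg : FiniteFibres g) (hh : FiniteFibres h) :
    theta R (Sum.elim g h) = theta R g + theta R h := by
  ext n
  have : Finite {i // Sum.elim g h (.inl i) = n} := hg n
  have : Finite {k // Sum.elim g h (.inr k) = n} := hh n
  simp only [theta, coeff_mk, map_add]
  rw [Nat.card_congr (Equiv.subtypeSum (p := fun x ↦ Sum.elim g h x = n)), Nat.card_sum]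
  simp

theorem theta_mul {g : ι → ℤ} {h : κ → ℤ} (hg : FiniteFibres g) (hh : FiniteFibres h)
    (hg0 : ∀ i, 0 ≤ g i) (hh0 : ∀ i, 0 ≤ h i) :
    theta R g * theta R h = theta R fun p : ι × κ ↦ g p.1 + h p.2 := by
  ext n
  simp only [theta, coeff_mk, coeff_mul]
  let e : {p : ι × κ // g p.1 + h p.2 = n} ≃
      Σ x : Finset.HasAntidiagonal.antidiagonal n, {i // g i = x.1.1} × {k // h k = x.1.2} :=
    { toFun p := ⟨⟨((g p.1.1).toNat, (h p.1.2).toNat), by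
        have := p.2; have := hg0 p.1.1; have := hh0 p.1.2; simp; omega⟩,
        ⟨p.1.1, by simp [hg0]⟩, ⟨p.1.2, by simp [hh0]⟩⟩
      invFun x := ⟨(x.2.1, x.2.2), by
        have := Finset.HasAntidiagonal.mem_antidiagonal.1 x.1.2
        rw [x.2.1.2, x.2.2.2]; exact_mod_cast this⟩
      left_inv p := rfl
      right_inv := by
        rintro ⟨⟨⟨a, b⟩, hab⟩, ⟨i, hi⟩, ⟨k, hk⟩⟩
        simp only at hi hk
        obtain rfl : (g i).toNat = a := by omega
        obtain rfl : (h k).toNat = b := by omega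
        rfl }
  have (x : Finset.HasAntidiagonal.antidiagonal n) :
      Finite ({i // g i = x.1.1} × {k // h k = x.1.2}) :=
    have := hg x.1.1
    have := hh x.1.2
    inferInstance
  rw [Nat.card_congr e, Nat.card_sigma, ← Finset.sum_coe_sort]
  simp [Nat.card_prod]

theorem theta_add_one {g : ι → ℤ} (hg0 : ∀ i, 0 ≤ g i) :
    theta R (fun i ↦ g i + 1) = X * theta R g := by
  ext n
  cases n with
  | zero =>
    have : IsEmpty {i // g i + 1 = (0 : ℕ)} := ⟨fun i ↦ by have := i.2; have := hg0 i; omega⟩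
    simp [theta]
  | succ n => simp [theta, coeff_succ_X_mul]

theorem theta_mul_left (k : ℕ) (hk : k ≠ 0) (g : ι → ℤ) :
    theta R (fun i ↦ k * g i) = expand k hk (theta R g) := by
  ext n
  by_cases h : k ∣ n
  · obtain ⟨m, rfl⟩ := h
    simp [theta, hk]
  · rw [coeff_expand_of_not_dvd k hk _ h]
    have : IsEmpty {i // k * g i = n} :=
      ⟨fun i ↦ h (Int.natCast_dvd_natCast.1 ⟨_, i.2.symm⟩)⟩
    simp [theta]

theorem FiniteFibres.of_abs_le {g : ℤ → ℤ} (h : ∀ n, |n| ≤ g n) : FiniteFibres g := fun m ↦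
  Set.Finite.subset (Set.finite_Icc (-m : ℤ) m) fun i (hi : g i = m) ↦ by
    have := h i
    rw [hi, abs_le] at this
    exact this

theorem FiniteFibres.of_natCast_le {g : ℕ → ℤ} (h : ∀ n, n ≤ g n) : FiniteFibres g := fun m ↦
  Set.Finite.subset (Set.finite_Iic m) fun i (hi : g i = m) ↦ by
    have := h i
    rw [hi] at this
    exact_mod_cast this

theorem FiniteFibres.prod {g : ι → ℤ} {h : κ → ℤ} (hg : FiniteFibres g) (hh : FiniteFibres h)
    (hg0 : ∀ i, 0 ≤ g i) (hh0 : ∀ i, 0 ≤ h i) :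
    FiniteFibres fun p : ι × κ ↦ g p.1 + h p.2 := fun n ↦ by
  have hG : (⋃ m ∈ Finset.range (n + 1), {i | g i = (m : ℕ)}).Finite :=
    Set.Finite.biUnion (Finset.finite_toSet _) fun m _ ↦ hg m
  have hH : (⋃ m ∈ Finset.range (n + 1), {i | h i = (m : ℕ)}).Finite :=
    Set.Finite.biUnion (Finset.finite_toSet _) fun m _ ↦ hh m
  refine Set.Finite.subset (hG.prod hH) fun p (hp : g p.1 + h p.2 = n) ↦ ?_
  have := hg0 p.1
  have := hh0 p.2
  simp only [Set.mem_prod, Set.mem_iUnion, Finset.mem_range]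
  exact ⟨⟨(g p.1).toNat, by omega, by simp; omega⟩, ⟨(h p.2).toNat, by omega, by simp; omega⟩⟩

theorem FiniteFibres.sumElim {g : ι → ℤ} {h : κ → ℤ} (hg : FiniteFibres g) (hh : FiniteFibres h) :
    FiniteFibres (Sum.elim g h) := fun n ↦ by
  have : Finite {i // Sum.elim g h (.inl i) = n} := hg n
  have : Finite {k // Sum.elim g h (.inr k) = n} := hh n
  exact Finite.of_equiv _ (Equiv.subtypeSum (p := fun x ↦ Sum.elim g h x = n)).symm

/-- Ramanujan's theta series `φ(q) = ∑ q ^ (n ^ 2)`. -/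
noncomputable def phi (R : Type*) [CommRing R] : R⟦X⟧ := theta R fun n : ℤ ↦ n ^ 2

/-- Ramanujan's theta series `ψ(q) = ∑ q ^ (n * (2 * n + 1))`, the sum over `n : ℤ`. -/
noncomputable def psi (R : Type*) [CommRing R] : R⟦X⟧ := theta R fun n : ℤ ↦ n * (2 * n + 1)

theorem abs_le_sq_int (n : ℤ) : |n| ≤ n ^ 2 := by
  rw [← sq_abs]
  exact Int.le_self_sq _

theorem abs_le_mul_two_mul_add_one (n : ℤ) : |n| ≤ n * (2 * n + 1) := by
  rcases abs_cases n with ⟨h, _⟩ | ⟨h, _⟩ <;> rw [h] <;> nlinarith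

theorem mul_two_mul_add_one_nonneg (n : ℤ) : 0 ≤ n * (2 * n + 1) :=
  (abs_nonneg n).trans (abs_le_mul_two_mul_add_one n)

theorem FiniteFibres.comp_injective {g : ι → ℤ} (hg : FiniteFibres g) {f : κ → ι}
    (hf : f.Injective) : FiniteFibres fun k ↦ g (f k) := fun n ↦
  have := hg n
  Finite.of_injective (fun k : {k // g (f k) = n} ↦ (⟨f k, k.2⟩ : {i // g i = n}))
    fun _ _ h ↦ Subtype.ext (hf (congrArg Subtype.val h))

theorem finiteFibres_sq : FiniteFibres fun n : ℤ ↦ n ^ 2 := .of_abs_le abs_le_sq_int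

theorem finiteFibres_natCast_mul_sq (k : ℕ) (hk : k ≠ 0) :
    FiniteFibres fun n : ℤ ↦ k * n ^ 2 := .of_abs_le fun n ↦
  (abs_le_sq_int n).trans <| le_mul_of_one_le_left (sq_nonneg n) <| by
    exact_mod_cast Nat.one_le_iff_ne_zero.2 hk

theorem finiteFibres_mul_two_mul_add_one : FiniteFibres fun n : ℤ ↦ n * (2 * n + 1) :=
  .of_abs_le abs_le_mul_two_mul_add_one

/-- `φ(q) ψ(q²) = ψ(q)²`. -/
theorem phi_mul_psi : phi R * expand 2 two_ne_zero (psi R) = psi R ^ 2 := by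
  let e : ℤ × ℤ ≃ ℤ × ℤ :=
    { toFun p := (p.1 - p.2, if (p.1 - p.2) % 2 = 0 then (p.1 + p.2) / 2 else -(p.1 + p.2 + 1) / 2)
      invFun p := if p.1 % 2 = 0 then (p.1 / 2 + p.2, p.2 - p.1 / 2) else
        ((p.1 - 1) / 2 - p.2, - p.2 - (p.1 + 1) / 2)
      left_inv p := by ext <;> dsimp only <;> split_ifs <;> dsimp only <;> omega
      right_inv p := by ext <;> dsimp only <;> split_ifs <;> dsimp only at * <;> omega }
  rw [phi, psi, ← theta_mul_left, sq, theta_mul, theta_mul, ← theta_comp_equiv e]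
  · congr 1
    ext ⟨x, y⟩
    simp only [e, Equiv.coe_fn_mk]
    split_ifs with h
    · obtain ⟨k, hk⟩ : ∃ k, x = y + 2 * k := ⟨(x - y) / 2, by omega⟩
      rw [show (x + y) / 2 = y + k by omega, hk]
      push_cast
      ring
    · obtain ⟨k, hk⟩ : ∃ k, x = y + 2 * k + 1 := ⟨(x - y) / 2, by omega⟩
      rw [show -(x + y + 1) / 2 = - y - k - 1 by omega, hk]
      push_cast
      ring
  all_goals first
    | exact finiteFibres_mul_two_mul_add_one
    | exact mul_two_mul_add_one_nonneg
    | exact finiteFibres_sq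
    | exact sq_nonneg
    | skip
  · refine .of_abs_le fun n ↦ ?_
    have := abs_le_mul_two_mul_add_one n
    have := abs_nonneg n
    push_cast
    omega
  · exact fun n ↦ mul_nonneg (by simp) (mul_two_mul_add_one_nonneg n)

/-- `φ(q) = φ(q⁴) + 2 q ψ(q⁸)`. -/
theorem phi_eq : phi R =
    expand 4 four_ne_zero (phi R) + 2 * X * expand 8 (by simp) (psi R) := by
  let e : ℤ ⊕ (ℤ ⊕ ℤ) ≃ ℤ :=
    { toFun := Sum.elim (fun n ↦ 2 * n) (Sum.elim (fun n ↦ 4 * n + 1) fun n ↦ - (4 * n + 1))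
      invFun n := if n % 2 = 0 then .inl (n / 2) else
        if n % 4 = 1 then .inr (.inl (n / 4)) else .inr (.inr (- (n + 1) / 4))
      left_inv := by
        rintro (n | n | n) <;> simp only [Sum.elim_inl, Sum.elim_inr] <;> grind
      right_inv n := by dsimp only; split_ifs <;> simp only [Sum.elim_inl, Sum.elim_inr] <;> omega }
  have h8 : FiniteFibres fun n : ℤ ↦ (8 : ℕ) * (n * (2 * n + 1)) + 1 := .of_abs_le fun n ↦ by
    have := abs_le_mul_two_mul_add_one n
    have := abs_nonneg n
    push_cast
    omega
  have key : theta R (fun n : ℤ ↦ n ^ 2) = theta R (Sum.elim (fun n : ℤ ↦ (4 : ℕ) * n ^ 2)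
      (Sum.elim (fun n : ℤ ↦ (8 : ℕ) * (n * (2 * n + 1)) + 1)
        (fun n : ℤ ↦ (8 : ℕ) * (n * (2 * n + 1)) + 1))) := by
    rw [← theta_comp_equiv e]
    congr 1
    ext (n | n | n) <;> simp only [e, Equiv.coe_fn_mk, Sum.elim_inl, Sum.elim_inr] <;>
      push_cast <;> ring
  rw [theta_sumElim (finiteFibres_natCast_mul_sq 4 four_ne_zero) (h8.sumElim h8),
    theta_sumElim h8 h8,
    theta_add_one (fun n ↦ mul_nonneg (by simp) (mul_two_mul_add_one_nonneg n)),
    theta_mul_left 8 (by simp), theta_mul_left 4 four_ne_zero] at key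
  rw [phi, psi]
  linear_combination key

theorem finiteFibres_odd_sq : FiniteFibres fun n : ℤ ↦ (2 * n + 1) ^ 2 :=
  finiteFibres_sq.comp_injective fun a b h ↦ by simpa using h

theorem theta_odd_sq :
    theta R (fun n : ℤ ↦ (2 * n + 1) ^ 2) = phi R - expand 4 four_ne_zero (phi R) := by
  let e : ℤ ⊕ ℤ ≃ ℤ :=
    { toFun := Sum.elim (fun n ↦ 2 * n) (fun n ↦ 2 * n + 1)
      invFun n := if n % 2 = 0 then .inl (n / 2) else .inr (n / 2)
      left_inv := by rintro (n | n) <;> simp only [Sum.elim_inl, Sum.elim_inr] <;> grind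
      right_inv n := by dsimp only; split_ifs <;> simp only [Sum.elim_inl, Sum.elim_inr] <;> omega }
  rw [eq_sub_iff_add_eq', phi, ← theta_mul_left,
    ← theta_sumElim (finiteFibres_natCast_mul_sq 4 four_ne_zero) finiteFibres_odd_sq,
    ← theta_comp_equiv e]
  congr 1
  ext (n | n) <;> simp only [e, Equiv.coe_fn_mk, Sum.elim_inl, Sum.elim_inr]
  push_cast
  ring

/-- `φ(q)² = φ(q²)² + 4 q φ(q⁴) ψ(q⁸)`. -/
theorem phi_sq : phi R ^ 2 = expand 2 two_ne_zero (phi R) ^ 2 +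
    4 * X * expand 4 four_ne_zero (phi R) * expand 8 (by simp) (psi R) := by
  let e : (ℤ × ℤ) ⊕ ((ℤ × ℤ) ⊕ (ℤ × ℤ)) ≃ ℤ × ℤ :=
    { toFun := Sum.elim (fun p ↦ (p.1 + p.2, p.1 - p.2))
        (Sum.elim (fun p ↦ (2 * p.1, 2 * p.2 + 1)) fun p ↦ (2 * p.2 + 1, 2 * p.1))
      invFun p := if (p.1 + p.2) % 2 = 0 then .inl ((p.1 + p.2) / 2, (p.1 - p.2) / 2) else
        if p.1 % 2 = 0 then .inr (.inl (p.1 / 2, p.2 / 2)) else .inr (.inr (p.2 / 2, p.1 / 2))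
      left_inv := by
        rintro (⟨x, y⟩ | ⟨x, y⟩ | ⟨x, y⟩) <;> simp only [Sum.elim_inl, Sum.elim_inr] <;> grind
      right_inv p := by
        ext <;> dsimp only <;> split_ifs <;> simp only [Sum.elim_inl, Sum.elim_inr] <;> omega }
  have h2 := finiteFibres_natCast_mul_sq 2 two_ne_zero
  have h4 := finiteFibres_natCast_mul_sq 4 four_ne_zero
  have h2' (n : ℤ) : 0 ≤ (2 : ℕ) * n ^ 2 := by positivity
  have h4' (n : ℤ) : 0 ≤ (4 : ℕ) * n ^ 2 := by positivity
  have ho (n : ℤ) : 0 ≤ (2 * n + 1) ^ 2 := sq_nonneg _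
  have key : theta R (fun p : ℤ × ℤ ↦ p.1 ^ 2 + p.2 ^ 2) =
      theta R (Sum.elim (fun p : ℤ × ℤ ↦ (2 : ℕ) * p.1 ^ 2 + (2 : ℕ) * p.2 ^ 2)
        (Sum.elim (fun p : ℤ × ℤ ↦ (4 : ℕ) * p.1 ^ 2 + (2 * p.2 + 1) ^ 2)
          fun p : ℤ × ℤ ↦ (4 : ℕ) * p.1 ^ 2 + (2 * p.2 + 1) ^ 2)) := by
    rw [← theta_comp_equiv e]
    congr 1
    ext (⟨x, y⟩ | ⟨x, y⟩ | ⟨x, y⟩) <;>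
      simp only [e, Equiv.coe_fn_mk, Sum.elim_inl, Sum.elim_inr] <;> push_cast <;> ring
  have h4o := h4.prod finiteFibres_odd_sq h4' ho
  rw [theta_sumElim (h2.prod h2 h2' h2') (h4o.sumElim h4o), theta_sumElim h4o h4o,
    ← theta_mul h2 h2 h2' h2', ← theta_mul h4 finiteFibres_odd_sq h4' ho,
    ← theta_mul finiteFibres_sq finiteFibres_sq sq_nonneg sq_nonneg, theta_mul_left 2 two_ne_zero,
    theta_mul_left 4 four_ne_zero, theta_odd_sq, ← phi] at key
  linear_combination key + 2 * expand 4 four_ne_zero (phi R) * phi_eq (R := R)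

theorem coeff_evalNegHom (f : R⟦X⟧) (n : ℕ) :
    coeff n (evalNegHom f) = (-1) ^ n * coeff n f := by
  simp [evalNegHom, coeff_rescale]

theorem evalNegHom_expand {p : ℕ} (hp : p ≠ 0) (h2 : Even p) (f : R⟦X⟧) :
    evalNegHom (expand p hp f) = expand p hp f := by
  ext m
  rw [coeff_evalNegHom]
  by_cases h : p ∣ m
  · obtain ⟨m, rfl⟩ := h
    rw [(h2.mul_right m).neg_one_pow, one_mul]
  · rw [coeff_expand_of_not_dvd p hp _ h, mul_zero]

theorem expand_ne_zero {p : ℕ} (hp : p ≠ 0) {f : R⟦X⟧} (hf : f ≠ 0) : expand p hp f ≠ 0 := by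
  contrapose! hf
  ext m
  rw [← coeff_expand_mul p hp, hf, map_zero, map_zero]

/-- The finite form, due to Shanks, of the Gauss identity for `ψ`. -/
theorem prod_odd_mul_sum_triangular (q : R) (n : ℕ) :
    (∏ k ∈ Finset.range n, (1 - q ^ (2 * k + 1))) *
      ∑ k ∈ Finset.range n, (q ^ (k * (2 * k + 1)) + q ^ ((k + 1) * (2 * k + 1))) =
    ∑ s ∈ Finset.range n, (∏ k ∈ Finset.range s, (1 - q ^ (2 * k + 1))) *
      (∏ k ∈ Finset.Ico s n, (1 - q ^ (2 * k + 2))) * q ^ (s * (2 * n + 1)) := by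
  induction n with
  | zero => simp
  | succ n ih =>
    have tel : ∀ m ≤ n, ∑ s ∈ Finset.range m, ((∏ k ∈ Finset.range s, (1 - q ^ (2 * k + 1))) *
        (∏ k ∈ Finset.Ico s (n + 1), (1 - q ^ (2 * k + 2))) * q ^ (s * (2 * (n + 1) + 1)) -
        (1 - q ^ (2 * n + 1)) * ((∏ k ∈ Finset.range s, (1 - q ^ (2 * k + 1))) *
        (∏ k ∈ Finset.Ico s n, (1 - q ^ (2 * k + 2))) * q ^ (s * (2 * n + 1)))) =
        (∏ k ∈ Finset.range m, (1 - q ^ (2 * k + 1))) *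
        (∏ k ∈ Finset.Ico m n, (1 - q ^ (2 * k + 2))) * (1 - q ^ (2 * m)) *
          q ^ (m * (2 * n + 1)) := by
      intro m hm
      induction m with
      | zero => simp
      | succ m ihm =>
        rw [Finset.sum_range_succ, ihm (by omega), Finset.prod_range_succ,
          Finset.prod_Ico_succ_top (by omega),
          Finset.prod_eq_prod_Ico_succ_bot (show m < n by omega)]
        ring
    have h := tel n le_rfl
    rw [Finset.sum_sub_distrib, ← Finset.mul_sum, ← ih, Finset.Ico_self, Finset.prod_empty] at h
    rw [Finset.prod_range_succ, Finset.sum_range_succ, Finset.sum_range_succ,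
      Nat.Ico_succ_singleton, Finset.prod_singleton]
    linear_combination -h

theorem prod_range_two_mul (q : R) (n : ℕ) :
    ∏ k ∈ Finset.range (2 * n), (1 - q ^ (k + 1)) =
      (∏ k ∈ Finset.range n, (1 - q ^ (2 * k + 1))) *
        ∏ k ∈ Finset.range n, (1 - q ^ (2 * k + 2)) := by
  induction n with
  | zero => simp
  | succ n ih =>
    rw [show 2 * (n + 1) = 2 * n + 1 + 1 by ring, Finset.prod_range_succ, Finset.prod_range_succ,
      ih, Finset.prod_range_succ, Finset.prod_range_succ]
    ring

theorem psi_eq_theta_nat : psi R = theta R (fun k : ℕ ↦ ((k * (2 * k + 1) : ℕ) : ℤ)) +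
    theta R (fun k : ℕ ↦ (((k + 1) * (2 * k + 1) : ℕ) : ℤ)) := by
  rw [← theta_sumElim, psi, ← theta_comp_equiv Equiv.intEquivNatSumNat.symm]
  · congr 1
    ext (n | n)
    · simp [Equiv.intEquivNatSumNat]
    · simp [Equiv.intEquivNatSumNat, Int.negSucc_eq]
      ring
  all_goals
    refine .of_natCast_le fun n ↦ ?_
    push_cast
    nlinarith

section Topology

variable [TopologicalSpace R]

/-- Euler's product `∏ (1 - q ^ n)` over `n ≥ 1`. -/
noncomputable def euler (R : Type*) [CommRing R] [TopologicalSpace R] : R⟦X⟧ :=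
  ∏' n, (1 - X ^ (n + 1))

theorem tendsto_sum_pow_theta {g : ℕ → ℕ} (hg : ∀ n, n ≤ g n) :
    Tendsto (fun n ↦ ∑ k ∈ Finset.range n, (X : R⟦X⟧) ^ g k) atTop
      (𝓝 (theta R fun k : ℕ ↦ (g k : ℤ))) := by
  rw [WithPiTopology.tendsto_iff_coeff_tendsto]
  refine fun m ↦ tendsto_const_nhds.congr' ?_
  filter_upwards [eventually_gt_atTop m] with n hn
  simp only [theta, coeff_mk, map_sum, coeff_X_pow, Nat.cast_inj, Finset.sum_boole]
  congr 1
  rw [Nat.subtype_card]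
  intro k
  have := hg k
  simp only [Finset.mem_filter, Finset.mem_range]
  omega

theorem tendsto_prod_euler :
    Tendsto (fun n ↦ ∏ k ∈ Finset.range n, (1 - (X : R⟦X⟧) ^ (k + 1))) atTop (𝓝 (euler R)) :=
  (WithPiTopology.multipliable_one_sub_X_pow R).hasProd.tendsto_prod_nat

theorem continuous_expand (p : ℕ) (hp : p ≠ 0) :
    Continuous (expand p hp : R⟦X⟧ → R⟦X⟧) := by
  rw [continuous_iff_continuousAt]
  intro f
  rw [ContinuousAt, WithPiTopology.tendsto_iff_coeff_tendsto]
  intro m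
  by_cases h : p ∣ m
  · obtain ⟨m, rfl⟩ := h
    simp only [coeff_expand_mul]
    exact (WithPiTopology.continuous_coeff R m).continuousAt
  · simp only [coeff_expand_of_not_dvd p hp _ h]
    exact tendsto_const_nhds

theorem tendsto_prod_expand_euler (p : ℕ) (hp : p ≠ 0) :
    Tendsto (fun n ↦ ∏ k ∈ Finset.range n, (1 - (X : R⟦X⟧) ^ (p * (k + 1)))) atTop
      (𝓝 (expand p hp (euler R))) := by
  have := ((continuous_expand p hp).tendsto _).comp (tendsto_prod_euler (R := R))
  refine this.congr fun n ↦ ?_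
  simp [map_prod, pow_mul]

variable [DiscreteTopology R]

theorem continuous_evalNegHom : Continuous (evalNegHom : R⟦X⟧ → R⟦X⟧) := by
  rw [continuous_iff_continuousAt]
  intro f
  rw [ContinuousAt, WithPiTopology.tendsto_iff_coeff_tendsto]
  intro m
  simp only [coeff_evalNegHom]
  exact ((WithPiTopology.continuous_coeff R m).const_mul _).continuousAt

/-- The Gauss identity `ψ(q) ∏ (1 - q ^ n) = ∏ (1 - q ^ (2 * n)) ^ 2`. -/
theorem euler_mul_psi : euler R * psi R = expand 2 two_ne_zero (euler R) ^ 2 := by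
  have h2n : Tendsto (fun n : ℕ ↦ 2 * n) atTop atTop := tendsto_id.const_mul_atTop' two_pos
  have hE := tendsto_prod_expand_euler (R := R) 2 two_ne_zero
  have hψ := (tendsto_sum_pow_theta (R := R) (g := fun k ↦ k * (2 * k + 1))
    fun k ↦ by nlinarith).add (tendsto_sum_pow_theta (R := R)
      (g := fun k ↦ (k + 1) * (2 * k + 1)) fun k ↦ by nlinarith)
  rw [← psi_eq_theta_nat] at hψ
  have hl := (tendsto_prod_euler.comp h2n).mul hψ
  have hr : Tendsto (fun n ↦ ∑ s ∈ Finset.range n,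
      (∏ k ∈ Finset.range s, (1 - (X : R⟦X⟧) ^ (2 * k + 1))) *
      (∏ k ∈ Finset.Ico s n, (1 - X ^ (2 * k + 2))) * X ^ (s * (2 * n + 1))) atTop
      (𝓝 (expand 2 two_ne_zero (euler R))) := by
    rw [WithPiTopology.tendsto_iff_coeff_tendsto] at hE ⊢
    refine fun m ↦ (hE m).congr' ?_
    filter_upwards [eventually_gt_atTop m] with n hn
    obtain ⟨n, rfl⟩ := Nat.exists_eq_add_of_lt (Nat.zero_lt_of_lt hn)
    rw [Finset.sum_range_succ', map_add, map_sum, Finset.sum_eq_zero, zero_add]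
    · simp [mul_add]
    · intro s _
      rw [coeff_mul_X_pow', if_neg]
      nlinarith
  rw [sq]
  refine tendsto_nhds_unique hl ((hE.mul hr).congr fun n ↦ ?_)
  rw [← prod_odd_mul_sum_triangular, ← Finset.sum_add_distrib, Function.comp_apply,
    prod_range_two_mul]
  simp only [mul_add, mul_one]
  ring

theorem evalNegHom_euler_mul : evalNegHom (euler R) * euler R * expand 4 four_ne_zero (euler R) =
    expand 2 two_ne_zero (euler R) ^ 3 := by
  have h2n : Tendsto (fun n : ℕ ↦ 2 * n) atTop atTop := tendsto_id.const_mul_atTop' two_pos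
  have h1 := tendsto_prod_euler (R := R)
  have h2 := tendsto_prod_expand_euler (R := R) 2 two_ne_zero
  have h4 := tendsto_prod_expand_euler (R := R) 4 four_ne_zero
  have hN := (continuous_evalNegHom.tendsto _).comp h1
  have hl := ((hN.comp h2n).mul (h1.comp h2n)).mul h4
  have hr := (h2.comp h2n).mul (h2.pow 2)
  rw [pow_succ']
  refine tendsto_nhds_unique hl (hr.congr fun n ↦ ?_)
  simp only [Function.comp_apply, map_prod, map_sub, map_one, map_pow, evalNegHom_X]
  induction n with
  | zero => simp
  | succ n ih =>
    simp only [show 2 * (n + 1) = 2 * n + 1 + 1 by ring, Finset.prod_range_succ] at ih ⊢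
    have e1 : (-X : R⟦X⟧) ^ (2 * n + 1) = - X ^ (2 * n + 1) := Odd.neg_pow (by simp) _
    have e2 : (-X : R⟦X⟧) ^ (2 * n + 1 + 1) = X ^ (2 * n + 1 + 1) := Even.neg_pow (by grind) _
    rw [e1, e2]
    linear_combination (1 - X ^ (2 * (2 * n + 1))) * (1 - X ^ (2 * (2 * n + 1 + 1))) *
      (1 - X ^ (2 * (n + 1))) ^ 2 * ih

theorem euler_ne_zero [Nontrivial R] : euler R ≠ 0 :=
  WithPiTopology.tprod_one_sub_X_pow_ne_zero R

variable [IsDomain R]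

/-- The Gauss identity `φ(-q) ∏ (1 - q ^ (2 * n)) = ∏ (1 - q ^ n) ^ 2`. -/
theorem evalNegHom_phi_mul :
    evalNegHom (phi R) * expand 2 two_ne_zero (euler R) = euler R ^ 2 := by
  have h2 := expand_ne_zero two_ne_zero (euler_ne_zero (R := R))
  have h4 := expand_ne_zero four_ne_zero (euler_ne_zero (R := R))
  have hψ := congrArg evalNegHom (euler_mul_psi (R := R))
  have hψ2 := congrArg (expand 2 two_ne_zero) (euler_mul_psi (R := R))
  have hφ := congrArg evalNegHom (phi_mul_psi (R := R))
  have hN := evalNegHom_euler_mul (R := R)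
  have h22 : expand 2 two_ne_zero (expand 2 two_ne_zero (euler R)) =
      expand 4 four_ne_zero (euler R) := (expand_mul 2 two_ne_zero 2 two_ne_zero _).symm
  simp only [map_mul, map_pow, evalNegHom_expand two_ne_zero even_two, h22] at hψ hψ2 hφ
  have hg : evalNegHom (euler R) ≠ 0 := by
    intro h
    rw [h, zero_mul, zero_mul] at hN
    exact pow_ne_zero 3 h2 hN.symm
  clear h22
  generalize expand 4 _ (euler R) = f₄ at *
  generalize expand 2 _ (euler R) = f₂ at *
  refine mul_right_cancel₀ (pow_ne_zero 2 (mul_ne_zero h4 hg)) ?_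
  linear_combination -evalNegHom (phi R) * f₂ * evalNegHom (euler R) ^ 2 * hψ2 +
    f₂ ^ 2 * evalNegHom (euler R) ^ 2 * hφ +
    f₂ ^ 2 * (evalNegHom (euler R) * evalNegHom (psi R) + f₂ ^ 2) * hψ -
    (evalNegHom (euler R) * euler R * f₄ + f₂ ^ 3) * hN

/-- The odd part of `∏ (1 - q ^ n) ^ 8` is `-8 q ∏ (1 - q ^ (4 * n)) ^ 8`. -/
theorem euler_pow_eight_sub : euler R ^ 8 - evalNegHom (euler R ^ 8) =
    - 16 * X * expand 4 four_ne_zero (euler R ^ 8) := by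
  have h22 (f : R⟦X⟧) : expand 2 two_ne_zero (expand 2 two_ne_zero f) = expand 4 four_ne_zero f :=
    (expand_mul 2 two_ne_zero 2 two_ne_zero _).symm
  have h42 (f : R⟦X⟧) : expand 4 four_ne_zero (expand 2 two_ne_zero f) = expand 8 (by simp) f :=
    (expand_mul 4 four_ne_zero 2 two_ne_zero _).symm
  have hφ := phi_eq (R := R)
  have hφ2 := phi_sq (R := R)
  have hN := congrArg evalNegHom hφ
  have hf := evalNegHom_phi_mul (R := R)
  rw [hN] at hf
  have hf' := congrArg evalNegHom hf
  have hψ2 := congrArg (expand 2 two_ne_zero) (euler_mul_psi (R := R))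
  have hc := congrArg (expand 2 two_ne_zero) (phi_mul_psi (R := R))
  have hd := congrArg (expand 4 four_ne_zero) (phi_mul_psi (R := R))
  simp only [map_mul, map_add, map_neg, map_ofNat, map_pow, evalNegHom_X, neg_neg, h22, h42,
    evalNegHom_expand two_ne_zero even_two, evalNegHom_expand four_ne_zero (by decide : Even 4),
    evalNegHom_expand (by simp : (8 : ℕ) ≠ 0) (by decide : Even 8)] at hf hf' hψ2 hc hd ⊢
  clear h22 h42 hN
  generalize expand 8 _ (psi R) = b at *
  generalize expand 4 _ (phi R) = a at *
  generalize expand 2 _ (phi R) = c at *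
  generalize expand 4 _ (psi R) = d at *
  generalize expand 2 _ (psi R) = e at *
  generalize expand 2 _ (euler R) = f₂ at *
  generalize expand 4 _ (euler R) = f₄ at *
  have hc2 : a ^ 2 + 4 * X ^ 2 * b ^ 2 = c ^ 2 := by
    linear_combination hφ2 - (phi R + a + 2 * X * b) * hφ
  have h8 : euler R ^ 8 = ((a + 2 * -X * b) * f₂) ^ 4 := by rw [hf]; ring
  have h8' : evalNegHom (euler R) ^ 8 = ((a + 2 * X * b) * f₂) ^ 4 := by rw [hf']; ring
  have key : f₂ ^ 4 * (a * b) * (a ^ 2 + 4 * X ^ 2 * b ^ 2) = f₄ ^ 8 := by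
    rw [hc2, hd, show f₂ ^ 4 * d ^ 2 * c ^ 2 = f₂ ^ 4 * (c * d) ^ 2 by ring, hc,
      show f₂ ^ 4 * (e ^ 2) ^ 2 = (f₂ * e) ^ 4 by ring, hψ2]
    ring
  rw [h8, h8', ← key]
  ring

end Topology

theorem cast_numRegular_nine (n : ℕ) :
    (numRegular 9 n : ZMod 3) = coeff n (euler (ZMod 3) ^ 8) := by
  have h : (PowerSeries.mk fun n ↦ (numRegular 9 n : ZMod 3)) = euler (ZMod 3) ^ 8 := by
    have h1 (n : ℕ) : numRegular 9 n = (Nat.Partition.countRestricted n 9).card :=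
      Nat.Partition.card_restricted_eq_card_countRestricted n (by norm_num)
    simp only [h1]
    have hp := WithPiTopology.multipliable_one_sub_X_pow (ZMod 3)
    rw [Nat.Partition.powerSeriesMk_card_countRestricted_eq_tprod _ (by norm_num), euler,
      ← hp.tprod_pow]
    refine tprod_congr fun i ↦ ?_
    have h3 : (3 : (ZMod 3)⟦X⟧) = 0 := by
      rw [← map_ofNat (C (R := ZMod 3)), show (OfNat.ofNat 3 : ZMod 3) = 0 from rfl, map_zero]
    simp only [Finset.sum_range_succ, Finset.sum_range_zero, pow_mul]
    generalize (X : (ZMod 3)⟦X⟧) ^ (i + 1) = Y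
    linear_combination (3 * Y - 9 * Y ^ 2 + 19 * Y ^ 3 - 23 * Y ^ 4 + 19 * Y ^ 5 - 9 * Y ^ 6 +
      3 * Y ^ 7) * h3
  rw [← h, coeff_mk]

theorem cast_numRegular_nine_odd (n : ℕ) : (numRegular 9 (2 * n + 1) : ZMod 3) =
    coeff (2 * n) (expand 4 four_ne_zero (euler (ZMod 3) ^ 8)) := by
  have h := congrArg (coeff (2 * n + 1)) (euler_pow_eight_sub (R := ZMod 3))
  rw [cast_numRegular_nine]
  have h16 : (-16 : (ZMod 3)⟦X⟧) = C 2 := by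
    rw [← map_ofNat (C (R := ZMod 3)), ← map_neg]
    congr 1
  rw [map_sub, coeff_evalNegHom, h16, mul_assoc, coeff_C_mul, coeff_succ_X_mul,
    Odd.neg_one_pow (by simp), neg_one_mul, sub_neg_eq_add, ← two_mul] at h
  exact mul_left_cancel₀ (by decide) h

theorem three_dvd_numRegular_nine (n : ℕ) : 3 ∣ numRegular 9 (4 * n + 3) := by
  rw [← ZMod.natCast_eq_zero_iff, show 4 * n + 3 = 2 * (2 * n + 1) + 1 by ring,
    cast_numRegular_nine_odd, coeff_expand_of_not_dvd]
  omega

theorem three_dvd_numRegular_nine_iff (n : ℕ) :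
    3 ∣ numRegular 9 (4 * n + 1) ↔ 3 ∣ numRegular 9 n := by
  rw [← ZMod.natCast_eq_zero_iff, ← ZMod.natCast_eq_zero_iff,
    show 4 * n + 1 = 2 * (2 * n) + 1 by ring, cast_numRegular_nine_odd,
    show 2 * (2 * n) = 4 * n by ring, coeff_expand_mul, cast_numRegular_nine]

end RegularPartition

/-- For every positive integer `a` and nonnegative integer `n`,
`b_9(4^a·n + (10·4^(a-1) - 1)/3) ≡ 0 (mod 3)`. -/
theorem b9_power_of_four_family (a n : ℕ) (ha : 1 ≤ a) :
    3 ∣ numRegular 9 (4 ^ a * n + (10 * 4 ^ (a - 1) - 1) / 3) := by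
  induction a, ha using Nat.le_induction with
  | base => simpa using RegularPartition.three_dvd_numRegular_nine n
  | succ a ha ih =>
    obtain ⟨b, rfl⟩ := Nat.exists_eq_add_of_le' ha
    have h4 : 4 ^ b % 3 = 1 := by simp [Nat.pow_mod]
    have : 4 ^ (b + 1 + 1) * n + (10 * 4 ^ (b + 1 + 1 - 1) - 1) / 3 =
        4 * (4 ^ (b + 1) * n + (10 * 4 ^ (b + 1 - 1) - 1) / 3) + 1 := by
      simp only [Nat.add_sub_cancel, pow_succ (n := b + 1), pow_succ (n := b)]
      rw [mul_add, show 4 ^ b * 4 * 4 * n = 4 * (4 ^ b * 4 * n) by ring]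
      omega
    rw [this, RegularPartition.three_dvd_numRegular_nine_iff]
    exact ih
end

section
/- For every positive integer a, every nonnegative integer n, and every k ∈ {3, 13, 18, 23}, one has b_9(5^{2a} · n + (5^{2a−2} − 1)/3 + 5^{2a−2} · k) ≡ 0 (mod 3). (Note that 5^{2a−2} − 1 is divisible by 3, so the argument is a nonnegative integer.) -/
open PowerSeries Finset

section Dissection

variable {R : Type*} [CommRing R]

/-- The part of a power series supported on exponents congruent to `r` modulo `5`. -/
noncomputable def sieve (r : ℕ) (φ : R⟦X⟧) : R⟦X⟧ :=
  PowerSeries.mk fun n => if n % 5 = r then coeff n φ else 0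

/-- All exponents occurring in the power series are congruent to `r` modulo `5`. -/
def SupportedMod (r : ℕ) (φ : R⟦X⟧) : Prop :=
  ∀ n, n % 5 ≠ r → coeff n φ = 0

theorem supportedMod_sieve (r : ℕ) (φ : R⟦X⟧) : SupportedMod r (sieve r φ) := by
  intro n hn
  simp [sieve, hn]

theorem SupportedMod.add {r : ℕ} {φ ψ : R⟦X⟧} (hφ : SupportedMod r φ) (hψ : SupportedMod r ψ) :
    SupportedMod r (φ + ψ) := by
  intro n hn
  simp [hφ n hn, hψ n hn]

theorem SupportedMod.mul {r t : ℕ} {φ ψ : R⟦X⟧} (hφ : SupportedMod r φ) (hψ : SupportedMod t ψ)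
    (u : ℕ) (hu : (r + t) % 5 = u := by rfl) : SupportedMod u (φ * ψ) := by
  intro n hn
  rw [coeff_mul]
  refine sum_eq_zero fun z hz => ?_
  rw [HasAntidiagonal.mem_antidiagonal] at hz
  by_cases h₁ : z.1 % 5 = r
  · rw [hψ z.2 (by omega), mul_zero]
  · rw [hφ z.1 h₁, zero_mul]

theorem pentagonal_mod_five (k : ℤ) :
    (k % 5 = 0 ∧ pentagonal k % 5 = 0) ∨ (k % 5 = 1 ∧ pentagonal k % 5 = 1) ∨
    (k % 5 = 2 ∧ pentagonal k % 5 = 0) ∨ (k % 5 = 3 ∧ pentagonal k % 5 = 2) ∨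
    (k % 5 = 4 ∧ pentagonal k % 5 = 2) := by
  have h := two_mul_natCast_pentagonal k
  obtain ⟨q, r, hr, rfl⟩ : ∃ q r : ℤ, (r = 0 ∨ r = 1 ∨ r = 2 ∨ r = 3 ∨ r = 4) ∧ k = 5 * q + r :=
    ⟨k / 5, k % 5, by omega, by omega⟩
  rcases hr with rfl | rfl | rfl | rfl | rfl <;> ring_nf at h ⊢ <;> omega

theorem mem_Icc_of_pentagonal_le {k : ℤ} {N : ℕ} (h : pentagonal k ≤ N) :
    k ∈ Icc (-N : ℤ) N := by
  have h₁ := two_mul_natCast_pentagonal k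
  have h₂ : (pentagonal k : ℤ) ≤ N := by exact_mod_cast h
  rw [mem_Icc]
  constructor <;> nlinarith

theorem coeff_pentagonalSeries_eq_sum {n N : ℕ} (h : n ≤ N) :
    coeff n (pentagonalSeries R) =
      ∑ k ∈ Icc (-N : ℤ) N, if pentagonal k = n then ((k.negOnePow : ℤ) : R) else 0 := by
  by_cases hn : n ∈ Set.range pentagonal
  · obtain ⟨k, rfl⟩ := hn
    rw [coeff_pentagonalSeries_pentagonal]
    simp only [pentagonal_inj]
    rw [sum_ite_eq', if_pos (mem_Icc_of_pentagonal_le h)]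
  · rw [coeff_pentagonalSeries_eq_zero R hn]
    refine (sum_eq_zero fun k _ => if_neg fun hk => hn ⟨k, hk⟩).symm

theorem coeff_sieve_mul_sieve (r t N : ℕ) :
    coeff N (sieve r (pentagonalSeries R) * sieve t (pentagonalSeries R)) =
      ∑ z ∈ Icc (-N : ℤ) N ×ˢ Icc (-N : ℤ) N,
        if pentagonal z.1 + pentagonal z.2 = N ∧ pentagonal z.1 % 5 = r ∧ pentagonal z.2 % 5 = t
        then (((z.1 + z.2).negOnePow : ℤ) : R) else 0 := by
  have hs (u : ℕ) {i : ℕ} (hi : i ≤ N) : coeff i (sieve u (pentagonalSeries R)) =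
      ∑ k ∈ Icc (-N : ℤ) N,
        if pentagonal k = i ∧ i % 5 = u then ((k.negOnePow : ℤ) : R) else 0 := by
    rw [sieve, coeff_mk, coeff_pentagonalSeries_eq_sum hi]
    by_cases hu : i % 5 = u <;> simp [hu]
  rw [coeff_mul]
  have h₁ : ∀ x ∈ antidiagonal N, coeff x.1 (sieve r (pentagonalSeries R)) *
      coeff x.2 (sieve t (pentagonalSeries R)) = ∑ z ∈ Icc (-N : ℤ) N ×ˢ Icc (-N : ℤ) N,
        if x = (pentagonal z.1, pentagonal z.2) ∧ pentagonal z.1 % 5 = r ∧ pentagonal z.2 % 5 = t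
        then (((z.1 + z.2).negOnePow : ℤ) : R) else 0 := by
    rintro ⟨i, j⟩ hx
    rw [HasAntidiagonal.mem_antidiagonal] at hx
    dsimp only at hx ⊢
    rw [hs r (by omega), hs t (by omega), sum_mul_sum, sum_product]
    refine sum_congr rfl fun k _ => sum_congr rfl fun l _ => ?_
    rw [ite_zero_mul_ite_zero]
    congr 1
    · simp only [Prod.mk.injEq, eq_iff_iff]
      constructor
      · rintro ⟨⟨rfl, h⟩, rfl, h'⟩
        exact ⟨⟨rfl, rfl⟩, h, h'⟩
      · rintro ⟨⟨rfl, rfl⟩, h, h'⟩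
        exact ⟨⟨rfl, h⟩, rfl, h'⟩
    · simp [Int.negOnePow_add]
  rw [sum_congr rfl h₁, sum_comm]
  refine sum_congr rfl fun z _ => ?_
  by_cases hz : pentagonal z.1 % 5 = r ∧ pentagonal z.2 % 5 = t
  · simp [hz]
  · simp [hz]

/-- In the coordinates `x = 6 * k - 1`, `y = 6 * l - 1`, the form `x ^ 2 + y ^ 2` is invariant under
the reflection `(x, y) ↦ (-(3 * x + 4 * y) / 5, (3 * y - 4 * x) / 5)`, which acts on the sublattice
`x ≡ 2 * y [ZMOD 5]` and changes the sign attached to `(k, l)`. -/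
theorem sum_negOnePow_pentagonal_add_pentagonal_eq_zero (N : ℕ) :
    ∑ z ∈ Icc (-N : ℤ) N ×ˢ Icc (-N : ℤ) N,
      (if pentagonal z.1 + pentagonal z.2 = N ∧ (z.1 - 2 * z.2 + 1) % 5 = 0
        then (((z.1 + z.2).negOnePow : ℤ) : R) else 0) = 0 := by
  rw [← sum_filter]
  have key : ∀ k l : ℤ, (k - 2 * l + 1) % 5 = 0 → ∃ m : ℤ, k = 5 * m + 2 * l - 1 ∧
      (2 - 3 * k - 4 * l) / 5 = 1 - 3 * m - 2 * l ∧ (3 * l - 4 * k + 1) / 5 = 1 - 4 * m - l := by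
    intro k l h
    exact ⟨(k - 2 * l + 1) / 5, by omega, by omega, by omega⟩
  refine sum_involution
    (fun z _ => ((2 - 3 * z.1 - 4 * z.2) / 5, (3 * z.2 - 4 * z.1 + 1) / 5)) ?_ ?_ ?_ ?_
  · rintro ⟨k, l⟩ hz
    simp only [mem_filter] at hz ⊢
    obtain ⟨m, rfl, h₁, h₂⟩ := key k l hz.2.2
    rw [h₁, h₂, show (1 - 3 * m - 2 * l + (1 - 4 * m - l)) =
      (5 * m + 2 * l - 1 + l) + (1 + 2 * (1 - 6 * m - 3 * l)) by ring, Int.negOnePow_add _ (1 + _)]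
    simp [Int.negOnePow_add]
  · rintro ⟨k, l⟩ hz _ heq
    simp only [mem_filter] at hz
    obtain ⟨m, rfl, h₁, h₂⟩ := key k l hz.2.2
    simp only [h₁, h₂, Prod.mk.injEq] at heq
    omega
  · rintro ⟨k, l⟩ hz
    simp only [mem_filter, mem_product] at hz ⊢
    obtain ⟨m, rfl, h₁, h₂⟩ := key k l hz.2.2
    rw [h₁, h₂]
    have h : pentagonal (1 - 3 * m - 2 * l) + pentagonal (1 - 4 * m - l) = N := by
      rw [← hz.2.1]
      zify
      have e₁ := two_mul_natCast_pentagonal (1 - 3 * m - 2 * l)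
      have e₂ := two_mul_natCast_pentagonal (1 - 4 * m - l)
      have e₃ := two_mul_natCast_pentagonal (5 * m + 2 * l - 1)
      have e₄ := two_mul_natCast_pentagonal l
      linarith
    exact ⟨⟨mem_Icc_of_pentagonal_le (by omega), mem_Icc_of_pentagonal_le (by omega)⟩, h, by omega⟩
  · rintro ⟨k, l⟩ hz
    simp only [mem_filter] at hz
    obtain ⟨m, rfl, h₁, h₂⟩ := key k l hz.2.2
    simp only [h₁, h₂, Prod.mk.injEq]
    omega

theorem sieve_zero_mul_sieve_two :
    sieve 0 (pentagonalSeries R) * sieve 2 (pentagonalSeries R) =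
      -(sieve 1 (pentagonalSeries R)) ^ 2 := by
  rw [eq_neg_iff_add_eq_zero, sq]
  ext N
  rw [map_add, coeff_sieve_mul_sieve, coeff_sieve_mul_sieve, map_zero]
  refine Eq.trans ?_ (sum_negOnePow_pentagonal_add_pentagonal_eq_zero (R := R) N)
  set I := Icc (-N : ℤ) N
  have split₁ : ∑ z ∈ I ×ˢ I, (if pentagonal z.1 + pentagonal z.2 = N ∧ pentagonal z.1 % 5 = 0 ∧
        pentagonal z.2 % 5 = 2 then (((z.1 + z.2).negOnePow : ℤ) : R) else 0) =
      ∑ z ∈ I ×ˢ I, (if pentagonal z.1 + pentagonal z.2 = N ∧ pentagonal z.1 % 5 = 0 ∧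
        pentagonal z.2 % 5 = 2 ∧ (z.1 - 2 * z.2 + 1) % 5 = 0
        then (((z.1 + z.2).negOnePow : ℤ) : R) else 0) +
      ∑ z ∈ I ×ˢ I, (if pentagonal z.1 + pentagonal z.2 = N ∧ pentagonal z.1 % 5 = 0 ∧
        pentagonal z.2 % 5 = 2 ∧ (z.1 - 2 * z.2 + 1) % 5 ≠ 0
        then (((z.1 + z.2).negOnePow : ℤ) : R) else 0) := by
    rw [← sum_add_distrib]
    refine sum_congr rfl fun z _ => ?_
    by_cases h : (z.1 - 2 * z.2 + 1) % 5 = 0 <;> simp [h]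
  have swap : ∑ z ∈ I ×ˢ I, (if pentagonal z.1 + pentagonal z.2 = N ∧ pentagonal z.1 % 5 = 0 ∧
        pentagonal z.2 % 5 = 2 ∧ (z.1 - 2 * z.2 + 1) % 5 ≠ 0
        then (((z.1 + z.2).negOnePow : ℤ) : R) else 0) =
      ∑ z ∈ I ×ˢ I, (if pentagonal z.1 + pentagonal z.2 = N ∧ pentagonal z.1 % 5 = 2 ∧
        (z.1 - 2 * z.2 + 1) % 5 = 0
        then (((z.1 + z.2).negOnePow : ℤ) : R) else 0) := by
    rw [sum_product, sum_product_right]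
    refine sum_congr rfl fun k _ => sum_congr rfl fun l _ => ?_
    dsimp only
    rw [add_comm l k]
    have hk := pentagonal_mod_five k
    have hl := pentagonal_mod_five l
    exact if_congr (by omega) rfl rfl
  rw [split₁, swap, ← sum_add_distrib, ← sum_add_distrib]
  refine sum_congr rfl fun z _ => ?_
  have hk := pentagonal_mod_five z.1
  have hl := pentagonal_mod_five z.2
  by_cases hN : pentagonal z.1 + pentagonal z.2 = N
  · by_cases hz : (z.1 - 2 * z.2 + 1) % 5 = 0
    · rcases hk with hk | hk | hk | hk | hk
      · have : pentagonal z.2 % 5 = 2 := by omega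
        simp [hN, hz, hk, this]
      · have : pentagonal z.2 % 5 = 1 := by omega
        simp [hN, hz, hk, this]
      · have : pentagonal z.2 % 5 = 2 := by omega
        simp [hN, hz, hk, this]
      · simp [hN, hz, hk]
      · simp [hN, hz, hk]
    · have : ¬ (pentagonal z.1 % 5 = 1 ∧ pentagonal z.2 % 5 = 1) := by omega
      simp [hz, this]
  · simp [hN]

theorem sieve_one_pentagonalSeries :
    sieve 1 (pentagonalSeries R) = -(X * expand 25 (by norm_num) (pentagonalSeries R)) := by
  have hp (k : ℤ) : pentagonal (1 - 5 * k) = 25 * pentagonal k + 1 := by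
    have h₁ := two_mul_natCast_pentagonal (1 - 5 * k)
    have h₂ := two_mul_natCast_pentagonal k
    zify
    linarith
  ext n
  rw [map_neg]
  obtain _ | n := n
  · simp [sieve]
  rw [coeff_succ_X_mul, sieve, coeff_mk]
  by_cases hn : 25 ∣ n
  · obtain ⟨m, rfl⟩ := hn
    rw [coeff_expand_mul, if_pos (by omega)]
    by_cases hm : m ∈ Set.range pentagonal
    · obtain ⟨k, rfl⟩ := hm
      rw [← hp, coeff_pentagonalSeries_pentagonal, coeff_pentagonalSeries_pentagonal,
        show 1 - 5 * k = k + (1 + 2 * (-3 * k)) by ring, Int.negOnePow_add]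
      simp [Int.negOnePow_add]
    · rw [coeff_pentagonalSeries_eq_zero R hm, neg_zero]
      refine coeff_pentagonalSeries_eq_zero R fun ⟨k, hk⟩ => hm ?_
      have := pentagonal_mod_five k
      obtain ⟨l, rfl⟩ : ∃ l, k = 1 - 5 * l := ⟨(1 - k) / 5, by omega⟩
      rw [hp] at hk
      exact ⟨l, by omega⟩
  · rw [coeff_expand_of_not_dvd _ _ _ hn, neg_zero, ite_eq_right_iff]
    refine fun h => coeff_pentagonalSeries_eq_zero R fun ⟨k, hk⟩ => hn ?_
    have := pentagonal_mod_five k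
    obtain ⟨l, rfl⟩ : ∃ l, k = 1 - 5 * l := ⟨(1 - k) / 5, by omega⟩
    rw [hp] at hk
    exact ⟨pentagonal l, by omega⟩

theorem pentagonalSeries_eq_add_sieve :
    pentagonalSeries R = sieve 0 (pentagonalSeries R) + sieve 1 (pentagonalSeries R) +
      sieve 2 (pentagonalSeries R) := by
  ext n
  simp only [sieve, map_add, coeff_mk]
  by_cases hn : n ∈ Set.range pentagonal
  · obtain ⟨k, rfl⟩ := hn
    rcases pentagonal_mod_five k with h | h | h | h | h <;> simp [h]
  · simp [coeff_pentagonalSeries_eq_zero R hn]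

theorem coeff_sq_of_supportedMod {e₀ e₁ e₂ e₃ e₄ : R⟦X⟧} (h₀ : SupportedMod 0 e₀)
    (h₁ : SupportedMod 1 e₁) (h₂ : SupportedMod 2 e₂) (h₃ : SupportedMod 3 e₃)
    (h₄ : SupportedMod 4 e₄) {n : ℕ} (hn : n % 5 = 3) :
    coeff n ((e₀ + e₁ + e₂ + e₃ + e₄) ^ 2) = coeff n (2 * (e₀ * e₃ + e₁ * e₂) + e₄ ^ 2) := by
  have h : (e₀ + e₁ + e₂ + e₃ + e₄) ^ 2 - (2 * (e₀ * e₃ + e₁ * e₂) + e₄ ^ 2) =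
      (e₀ * e₀ + e₁ * e₄ + e₁ * e₄ + e₂ * e₃ + e₂ * e₃) +
      (e₀ * e₁ + e₀ * e₁ + e₂ * e₄ + e₂ * e₄ + e₃ * e₃) +
      (e₀ * e₂ + e₀ * e₂ + e₃ * e₄ + e₃ * e₄ + e₁ * e₁) +
      (e₀ * e₄ + e₀ * e₄ + e₁ * e₃ + e₁ * e₃ + e₂ * e₂) := by ring
  rw [← sub_eq_zero, ← map_sub, h]
  simp only [map_add, (h₀.mul h₀ 0) n (by omega), (h₁.mul h₄ 0) n (by omega),
    (h₂.mul h₃ 0) n (by omega), (h₀.mul h₁ 1) n (by omega), (h₂.mul h₄ 1) n (by omega),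
    (h₃.mul h₃ 1) n (by omega), (h₀.mul h₂ 2) n (by omega), (h₃.mul h₄ 2) n (by omega),
    (h₁.mul h₁ 2) n (by omega), (h₀.mul h₄ 4) n (by omega), (h₁.mul h₃ 4) n (by omega),
    (h₂.mul h₂ 4) n (by omega), add_zero]

theorem coeff_pentagonalSeries_pow_eight {n : ℕ} (hn : n % 5 = 3) :
    coeff n (pentagonalSeries R ^ 8) =
      coeff n (-125 * (X * expand 25 (by norm_num) (pentagonalSeries R)) ^ 8) := by
  have hAC := sieve_zero_mul_sieve_two (R := R)
  have hA := supportedMod_sieve 0 (pentagonalSeries R)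
  have hB := supportedMod_sieve 1 (pentagonalSeries R)
  have hC := supportedMod_sieve 2 (pentagonalSeries R)
  have hf := pentagonalSeries_eq_add_sieve (R := R)
  rw [← neg_eq_iff_eq_neg.mpr (sieve_one_pentagonalSeries (R := R))]
  generalize pentagonalSeries R = f at *
  generalize sieve 0 f = A at *
  generalize sieve 1 f = B at *
  generalize sieve 2 f = C at *
  have h₀ := hA.mul hA 0
  have h₁ := (hA.mul hB 1).add (hA.mul hB 1)
  have h₂ := ((hA.mul hC 2).add (hA.mul hC 2)).add (hB.mul hB 2)
  have h₃ := (hB.mul hC 3).add (hB.mul hC 3)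
  have h₄ := hC.mul hC 4
  have hF₀ := (h₀.mul h₀ 0).add (((h₁.mul h₄ 0).add (h₂.mul h₃ 0)).add
    ((h₁.mul h₄ 0).add (h₂.mul h₃ 0)))
  have hF₁ := (h₃.mul h₃ 1).add (((h₀.mul h₁ 1).add (h₂.mul h₄ 1)).add
    ((h₀.mul h₁ 1).add (h₂.mul h₄ 1)))
  have hF₂ := (h₁.mul h₁ 2).add (((h₀.mul h₂ 2).add (h₃.mul h₄ 2)).add
    ((h₀.mul h₂ 2).add (h₃.mul h₄ 2)))
  have hF₃ := (h₄.mul h₄ 3).add (((h₀.mul h₃ 3).add (h₁.mul h₂ 3)).add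
    ((h₀.mul h₃ 3).add (h₁.mul h₂ 3)))
  have hF₄ := (h₂.mul h₂ 4).add (((h₀.mul h₄ 4).add (h₁.mul h₃ 4)).add
    ((h₀.mul h₄ 4).add (h₁.mul h₃ 4)))
  have key := coeff_sq_of_supportedMod hF₀ hF₁ hF₂ hF₃ hF₄ hn
  convert key using 2
  · rw [hf]
    ring
  · linear_combination -(56 * A ^ 5 * B + 56 * B * C ^ 5 + 70 * (A * C) ^ 3 +
      490 * (A * C) ^ 2 * B ^ 2 - 70 * (A * C) * B ^ 4 + 126 * B ^ 6) * hAC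

theorem coeff_pentagonalSeries_pow_eight_of_mod_five {n : ℕ} (hn : n % 5 = 3)
    (hn' : n % 25 ≠ 8) : coeff n (pentagonalSeries R ^ 8) = 0 := by
  rw [coeff_pentagonalSeries_pow_eight hn, mul_pow, ← map_pow, mul_left_comm, coeff_X_pow_mul',
    show (-125 : R⟦X⟧) = C (-125) by rw [map_neg, map_ofNat], coeff_C_mul]
  split_ifs with h
  · rw [coeff_expand_of_not_dvd _ _ _ (by omega), mul_zero]
  · rfl

theorem coeff_pentagonalSeries_pow_eight_mul_add (m : ℕ) :
    coeff (25 * m + 8) (pentagonalSeries R ^ 8) = -125 * coeff m (pentagonalSeries R ^ 8) := by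
  rw [coeff_pentagonalSeries_pow_eight (by omega), mul_pow, ← map_pow, mul_left_comm,
    coeff_X_pow_mul, show (-125 : R⟦X⟧) = C (-125) by rw [map_neg, map_ofNat], coeff_C_mul, coeff_expand_mul]

end Dissection

theorem mk_numRegular_nine_eq :
    PowerSeries.mk (fun n => (numRegular 9 n : ZMod 3)) = pentagonalSeries (ZMod 3) ^ 8 := by
  let _ : TopologicalSpace (ZMod 3) := ⊥
  have _ : DiscreteTopology (ZMod 3) := ⟨rfl⟩
  have hG : PowerSeries.mk (fun n => (numRegular 9 n : ZMod 3)) =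
      PowerSeries.mk fun n => (#(Nat.Partition.countRestricted n 9) : ZMod 3) :=
    have : Fact (Nat.Prime 3) := ⟨Nat.prime_three⟩
    Nat.Partition.powerSeriesMk_card_restricted_eq_powerSeriesMk_card_countRestricted (ZMod 3)
      (m := 9) (by norm_num)
  rw [hG]
  open scoped PowerSeries.WithPiTopology in
  refine (Nat.Partition.hasProd_powerSeriesMk_card_countRestricted (ZMod 3)
    (m := 9) (by norm_num)).unique ?_
  open scoped PowerSeries.WithPiTopology in
  convert! (WithPiTopology.hasProd_one_sub_X_pow (ZMod 3)).pow 8 using 2 with i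
  have h₃ : (3 : (ZMod 3)⟦X⟧) = 0 := by
    rw [← map_ofNat (C (R := ZMod 3)) 3, show (OfNat.ofNat 3 : ZMod 3) = 0 from rfl, map_zero]
  simp only [pow_mul, sum_range_succ, sum_range_zero]
  generalize (X : (ZMod 3)⟦X⟧) ^ (i + 1) = Y
  linear_combination (3 * Y - 9 * Y ^ 2 + 19 * Y ^ 3 - 23 * Y ^ 4 + 19 * Y ^ 5 - 9 * Y ^ 6 +
    3 * Y ^ 7) * h₃

/-- For every positive integer `a`, nonnegative integer `n`, and `k ∈ {3, 13, 18, 23}`,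
`b_9(5^(2a)·n + (5^(2a-2) - 1)/3 + 5^(2a-2)·k) ≡ 0 (mod 3)`. -/
theorem b9_power_of_five_family (a n : ℕ) (ha : 1 ≤ a) (k : ℕ)
    (hk : k ∈ ({3, 13, 18, 23} : Finset ℕ)) :
    3 ∣ numRegular 9 (5 ^ (2 * a) * n + (5 ^ (2 * a - 2) - 1) / 3 + 5 ^ (2 * a - 2) * k) := by
  obtain ⟨b, rfl⟩ := Nat.exists_eq_add_of_le' ha
  rw [← CharP.cast_eq_zero_iff (ZMod 3) 3, ← coeff_mk _ (fun n => (numRegular 9 n : ZMod 3)),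
    mk_numRegular_nine_eq, show 2 * (b + 1) - 2 = 2 * b by omega,
    show 2 * (b + 1) = 2 * b + 2 by omega, pow_add, pow_mul]
  clear ha
  norm_num only
  induction b with
  | zero =>
    simp only [mem_insert, mem_singleton] at hk
    exact coeff_pentagonalSeries_pow_eight_of_mod_five (by omega) (by omega)
  | succ b ih =>
    have h : (25 ^ b - 1) % 3 = 0 := by
      have := Nat.sub_dvd_pow_sub_pow 25 1 b
      rw [one_pow] at this
      omega
    have hpos : 0 < 25 ^ b := by positivity
    have hidx : 25 ^ (b + 1) * 25 * n + (25 ^ (b + 1) - 1) / 3 + 25 ^ (b + 1) * k =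
        25 * (25 ^ b * 25 * n + (25 ^ b - 1) / 3 + 25 ^ b * k) + 8 := by
      have : (25 ^ (b + 1) - 1) / 3 = 25 * ((25 ^ b - 1) / 3) + 8 := by
        rw [pow_succ]
        omega
      rw [this]
      ring
    rw [hidx, coeff_pentagonalSeries_pow_eight_mul_add, ih, mul_zero]
end

section
/- For every nonnegative integer n: if n ≢ 1 (mod 5) then b_9(5n+3) ≡ 0 (mod 3), and if n = 5m+1 then b_9(5n+3) = b_9(25m+8) ≡ b_9(m) (mod 3). Equivalently, as formal power series over ℤ reduced mod 3, ∑_{n≥0} b_9(5n+3) q^n ≡ q · (q^{45};q^{45})_∞ / (q^5;q^5)_∞ (mod 3). -/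
open PowerSeries in
/-- The power series `∑ i, ε i * q ^ (f i)`, meaningful when the fibres of `f` are finite. -/
noncomputable def thetaSeries {R ι : Type*} [CommRing R] (f : ι → ℤ) (ε : ι → R) : R⟦X⟧ :=
  PowerSeries.mk fun n => ∑ᶠ i ∈ {i | f i = n}, ε i

section ThetaSeries

open PowerSeries

variable {R ι κ : Type*} [CommRing R]

lemma coeff_thetaSeries (f : ι → ℤ) (ε : ι → R) (n : ℕ) :
    coeff n (thetaSeries f ε) = ∑ᶠ i ∈ {i | f i = n}, ε i :=
  coeff_mk _ _

lemma thetaSeries_eq_of_equiv (e : ι ≃ κ) {f : ι → ℤ} {ε : ι → R} {g : κ → ℤ} {δ : κ → R}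
    (hf : ∀ i, f i = g (e i)) (hε : ∀ i, ε i = δ (e i)) :
    thetaSeries f ε = thetaSeries g δ := by
  ext n
  rw [coeff_thetaSeries, coeff_thetaSeries]
  refine finsum_mem_eq_of_bijOn e ⟨fun i hi => ?_, e.injective.injOn, fun j hj => ?_⟩
    fun i _ => hε i
  · simpa [← hf] using hi
  · exact ⟨e.symm j, by simpa [hf] using hj, by simp⟩

lemma thetaSeries_neg (f : ι → ℤ) (ε : ι → R) :
    thetaSeries f (fun i => -ε i) = -thetaSeries f ε := by
  ext n
  simp only [coeff_thetaSeries, map_neg, finsum_neg_distrib]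

/-- A theta series vanishes if its index set has a sign-reversing symmetry. -/
lemma thetaSeries_eq_zero_of_equiv [NoZeroDivisors R] (h2 : (2 : R) ≠ 0) (e : ι ≃ ι) {f : ι → ℤ}
    {ε : ι → R} (hf : ∀ i, f i = f (e i)) (hε : ∀ i, ε i = -ε (e i)) :
    thetaSeries f ε = 0 := by
  have h : thetaSeries f ε = -thetaSeries f ε := by
    rw [← thetaSeries_neg]
    exact thetaSeries_eq_of_equiv e hf hε
  ext n
  have hn := congrArg (coeff n) h
  rw [map_neg] at hn
  rw [map_zero]
  refine (mul_eq_zero.mp ?_).resolve_left h2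
  linear_combination hn

lemma thetaSeries_mul {f : ι → ℤ} {g : κ → ℤ} (hf : ∀ n, {i | f i = n}.Finite)
    (hg : ∀ n, {j | g j = n}.Finite) (hf0 : ∀ i, 0 ≤ f i) (hg0 : ∀ j, 0 ≤ g j)
    (ε : ι → R) (δ : κ → R) :
    thetaSeries f ε * thetaSeries g δ =
      thetaSeries (fun p : ι × κ => f p.1 + g p.2) (fun p => ε p.1 * δ p.2) := by
  ext n
  have hset : {p : ι × κ | f p.1 + g p.2 = n} =
      ⋃ x ∈ (↑(Finset.HasAntidiagonal.antidiagonal n) : Set (ℕ × ℕ)),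
        {i | f i = (x.1 : ℤ)} ×ˢ {j | g j = (x.2 : ℤ)} := by
    ext ⟨i, j⟩
    simp only [Set.mem_ofPred_eq, Set.mem_iUnion, Set.mem_prod, exists_prop, Finset.mem_coe,
      Finset.HasAntidiagonal.mem_antidiagonal, Prod.exists]
    constructor
    · intro h
      have := hf0 i
      have := hg0 j
      exact ⟨(f i).toNat, (g j).toNat, by omega, by omega, by omega⟩
    · rintro ⟨a, b, h, h1, h2⟩
      omega
  rw [coeff_mul, coeff_thetaSeries, hset, finsum_mem_biUnion, finsum_mem_coe_finset]
  · refine Finset.sum_congr rfl fun x _ => ?_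
    rw [coeff_thetaSeries, coeff_thetaSeries, finsum_mem_eq_finite_toFinset_sum _ (hf _),
      finsum_mem_eq_finite_toFinset_sum _ (hg _), Finset.sum_mul_sum, ← Finset.sum_product',
      ← finsum_mem_coe_finset]
    simp
  · rintro ⟨a, b⟩ _ ⟨c, d⟩ _ hne
    refine Set.disjoint_left.mpr ?_
    rintro ⟨i, j⟩ ⟨h1, h2⟩ ⟨h3, h4⟩
    simp only [Set.mem_ofPred_eq] at h1 h2 h3 h4
    exact hne (Prod.ext (by simp; omega) (by simp; omega))
  · exact Finset.finite_toSet _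
  · exact fun x _ => (hf _).prod (hg _)

lemma finite_setOf_add_eq {f : ι → ℤ} {g : κ → ℤ} (hf : ∀ n, {i | f i = n}.Finite)
    (hg : ∀ n, {j | g j = n}.Finite) (hf0 : ∀ i, 0 ≤ f i) (hg0 : ∀ j, 0 ≤ g j) (n : ℤ) :
    {p : ι × κ | f p.1 + g p.2 = n}.Finite := by
  refine ((Set.finite_Icc 0 n).biUnion fun a _ => (hf a).prod (hg (n - a))).subset ?_
  rintro ⟨i, j⟩ h
  have := hf0 i
  have := hg0 j
  simp only [Set.mem_ofPred_eq, Set.mem_iUnion, Set.mem_prod, Set.mem_Icc, exists_prop] at h ⊢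
  exact ⟨f i, by omega, rfl, by omega⟩

/-- A theta series splits along a decomposition of its index set into finitely many pieces. -/
lemma thetaSeries_eq_sum {m : ℕ} (h : Fin m × ι → κ) (hh : h.Bijective) {f : κ → ℤ}
    (hf : ∀ n, {k | f k = n}.Finite) (ε : κ → R) :
    thetaSeries f ε = ∑ c, thetaSeries (fun i => f (h (c, i))) (fun i => ε (h (c, i))) := by
  ext n
  have hinj : ∀ c, Function.Injective fun i => h (c, i) := fun c i j hij => by
    simpa using hh.1 hij
  have hset : {k | f k = n} = ⋃ c, (fun i => h (c, i)) '' {i | f (h (c, i)) = n} := by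
    ext k
    obtain ⟨⟨c, i⟩, rfl⟩ := hh.2 k
    simp only [Set.mem_ofPred_eq, Set.mem_iUnion, Set.mem_image]
    constructor
    · exact fun hk => ⟨c, i, hk, rfl⟩
    · rintro ⟨d, j, hj, hij⟩
      rwa [← hij]
  rw [map_sum, coeff_thetaSeries, hset, finsum_mem_iUnion, finsum_eq_sum_of_fintype]
  · refine Finset.sum_congr rfl fun c _ => ?_
    rw [coeff_thetaSeries, finsum_mem_image (hinj c).injOn]
  · intro c d hcd
    refine Set.disjoint_left.mpr ?_
    rintro _ ⟨i, _, rfl⟩ ⟨j, _, hj⟩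
    exact hcd (by simpa using congrArg Prod.fst (hh.1 hj).symm)
  · intro c
    refine (hf n).subset ?_
    rintro _ ⟨i, hi, rfl⟩
    exact hi

end ThetaSeries

/-- `3 * coreExponent (s, t) + 1` is the norm of the Eisenstein integer `(1 + 3 * s) + 3 * t * ω`;
the exponents of the generating function of 3-cores have this form. -/
def coreExponent (x : ℤ × ℤ) : ℤ :=
  3 * x.1 ^ 2 - 3 * x.1 * x.2 + 3 * x.2 ^ 2 + 2 * x.1 - x.2

lemma coreExponent_nonneg (x : ℤ × ℤ) : 0 ≤ coreExponent x := by
  obtain ⟨s, t⟩ := x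
  unfold coreExponent
  nlinarith [sq_nonneg (2 + 6 * s - 3 * t), sq_nonneg t]

lemma finite_setOf_coreExponent_eq (n : ℤ) : {x | coreExponent x = n}.Finite := by
  refine ((Set.finite_Icc (-(n + 1)) (n + 1)).prod (Set.finite_Icc (-(n + 1)) (n + 1))).subset ?_
  intro x hx
  have hn : 0 ≤ n := hx ▸ coreExponent_nonneg x
  obtain ⟨s, t⟩ := x
  simp only [Set.mem_ofPred_eq, coreExponent] at hx
  have ht : 27 * t ^ 2 ≤ 12 * n + 4 := by nlinarith [sq_nonneg (2 + 6 * s - 3 * t)]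
  have hs : 3 * (1 + 3 * s) ^ 2 ≤ 12 * n + 4 := by nlinarith [sq_nonneg (6 * t - 1 - 3 * s)]
  simp only [Set.mem_prod, Set.mem_Icc]
  refine ⟨⟨?_, ?_⟩, ?_, ?_⟩ <;> nlinarith

lemma dvd_of_five_dvd_norm {a b : ℤ} (h : 5 ∣ a ^ 2 - a * b + b ^ 2) : 5 ∣ a ∧ 5 ∣ b := by
  have key : ∀ x y : ZMod 5, x ^ 2 - x * y + y ^ 2 = 0 → x = 0 ∧ y = 0 := by decide
  have := key a b (by
    have := (ZMod.intCast_zmod_eq_zero_iff_dvd _ 5).mpr h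
    push_cast at this
    exact this)
  exact ⟨(ZMod.intCast_zmod_eq_zero_iff_dvd a 5).mp this.1,
    (ZMod.intCast_zmod_eq_zero_iff_dvd b 5).mp this.2⟩

lemma five_dvd_of_coreExponent_eq {x : ℤ × ℤ} {n : ℤ} (h : coreExponent x = 5 * n + 3) :
    5 ∣ 1 + 3 * x.1 ∧ 5 ∣ x.2 := by
  obtain ⟨s, t⟩ := x
  simp only [coreExponent] at h ⊢
  obtain ⟨h1, h2⟩ := dvd_of_five_dvd_norm (a := 1 + 3 * s) (b := 3 * t)
    ⟨3 * n + 2, by linear_combination 3 * h⟩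
  exact ⟨h1, by omega⟩

lemma coreExponent_five_mul (s t : ℤ) :
    coreExponent (-2 - 5 * s, -5 * t) = 25 * coreExponent (s, t) + 8 := by
  simp only [coreExponent]
  ring

lemma exists_eq_of_coreExponent_eq {x : ℤ × ℤ} {n : ℤ} (h : coreExponent x = 5 * n + 3) :
    ∃ s t, x = (-2 - 5 * s, -5 * t) := by
  obtain ⟨⟨a, ha⟩, b, hb⟩ := five_dvd_of_coreExponent_eq h
  exact ⟨(-2 - x.1) / 5, -b, Prod.ext (by dsimp only; omega) (by dsimp only; omega)⟩

section Core

open PowerSeries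

/-- The generating function of 3-cores. -/
noncomputable def coreSeries (R : Type*) [CommRing R] : R⟦X⟧ :=
  thetaSeries coreExponent fun _ => 1

variable (R : Type*) [CommRing R]

lemma coeff_coreSeries_eq_zero {n : ℕ} (hn : n % 5 ≠ 1) :
    coeff (5 * n + 3) (coreSeries R) = 0 := by
  have : {x | coreExponent x = ((5 * n + 3 : ℕ) : ℤ)} = ∅ := by
    refine Set.eq_empty_of_forall_notMem fun x hx => hn ?_
    have hx' : coreExponent x = 5 * (n : ℤ) + 3 := by simpa using hx
    obtain ⟨s, t, rfl⟩ := exists_eq_of_coreExponent_eq hx'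
    rw [coreExponent_five_mul] at hx'
    omega
  rw [coreSeries, coeff_thetaSeries, this, finsum_mem_empty]

lemma coeff_coreSeries_twentyFive_mul (m : ℕ) :
    coeff (25 * m + 8) (coreSeries R) = coeff m (coreSeries R) := by
  rw [coreSeries, coeff_thetaSeries, coeff_thetaSeries]
  refine (finsum_mem_eq_of_bijOn (fun x : ℤ × ℤ => (-2 - 5 * x.1, -5 * x.2)) ⟨?_, ?_, ?_⟩
    fun _ _ => rfl).symm
  · rintro ⟨s, t⟩ h
    simp only [Set.mem_ofPred_eq] at h ⊢
    rw [coreExponent_five_mul, h]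
    push_cast
    ring
  · rintro ⟨s, t⟩ _ ⟨s', t'⟩ _ h
    simp only [Prod.mk.injEq] at h ⊢
    omega
  · intro x hx
    simp only [Set.mem_ofPred_eq] at hx
    obtain ⟨s, t, rfl⟩ := exists_eq_of_coreExponent_eq (x := x) (n := 5 * m + 1)
      (by rw [hx]; push_cast; ring)
    refine ⟨(s, t), ?_, rfl⟩
    rw [coreExponent_five_mul] at hx
    simp only [Set.mem_ofPred_eq]
    omega

lemma finite_setOf_mul_pentagonal_eq {a : ℤ} (ha : a ≠ 0) (n : ℤ) :
    {k | a * (pentagonal k : ℤ) = n}.Finite := by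
  refine Set.Subsingleton.finite fun k hk l hl => pentagonal_injective ?_
  have := mul_left_cancel₀ ha (hk.trans (Eq.symm hl))
  exact_mod_cast this

lemma pentagonalSeries_eq_thetaSeries :
    pentagonalSeries R =
      thetaSeries (fun k => (pentagonal k : ℤ)) fun k => ((k.negOnePow : ℤ) : R) := by
  ext n
  rw [coeff_thetaSeries]
  by_cases h : n ∈ Set.range pentagonal
  · obtain ⟨k, rfl⟩ := h
    have : {i | (pentagonal i : ℤ) = (pentagonal k : ℕ)} = {k} := by
      ext i
      simp
    rw [this, finsum_mem_singleton, coeff_pentagonalSeries_pentagonal]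
  · have : {i | (pentagonal i : ℤ) = n} = ∅ := by
      refine Set.eq_empty_of_forall_notMem fun i hi => h ⟨i, ?_⟩
      exact_mod_cast hi
    rw [this, finsum_mem_empty, coeff_pentagonalSeries_eq_zero R h]

lemma expand_thetaSeries {ι : Type*} (p : ℕ) (hp : p ≠ 0) (f : ι → ℤ) (ε : ι → R) :
    expand p hp (thetaSeries f ε) = thetaSeries (fun i => p * f i) ε := by
  ext n
  rw [coeff_thetaSeries]
  by_cases h : p ∣ n
  · obtain ⟨m, rfl⟩ := h
    rw [coeff_expand_mul, coeff_thetaSeries]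
    simp [hp]
  · rw [coeff_expand_of_not_dvd _ _ _ h]
    have : {i | p * f i = n} = ∅ := by
      refine Set.eq_empty_of_forall_notMem fun i hi => h ?_
      exact Int.natCast_dvd_natCast.mp ⟨f i, Eq.symm hi⟩
    rw [this, finsum_mem_empty]

/-- The change of variables which splits the index set of the product of the generating function
of 3-cores and Euler's pentagonal series into three pieces. -/
def coreChange (x : Fin 3 × (ℤ × ℤ) × ℤ) : (ℤ × ℤ) × ℤ :=
  ((x.2.1.1 - x.2.2, x.2.1.1 - x.2.1.2), -(x.2.1.1 + x.2.1.2 + x.2.2 + (x.1 : ℕ)))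

lemma coreChange_bijective : Function.Bijective coreChange := by
  constructor
  · rintro ⟨c, ⟨p, q⟩, r⟩ ⟨c', ⟨p', q'⟩, r'⟩ h
    simp only [coreChange, Prod.mk.injEq] at h ⊢
    rw [Fin.ext_iff]
    omega
  · rintro ⟨⟨s, t⟩, k⟩
    refine ⟨(⟨((s + t - k) % 3).toNat, by omega⟩,
      ((s + t - k) / 3, (s + t - k) / 3 - t), (s + t - k) / 3 - s), ?_⟩
    simp only [coreChange, Prod.mk.injEq]
    omega

lemma two_mul_exponent_coreChange (c : Fin 3) (p q r : ℤ) :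
    2 * (coreExponent (coreChange (c, (p, q), r)).1 + pentagonal (coreChange (c, (p, q), r)).2) =
      3 * (p * (3 * p + 1) + q * (3 * q + 1) + r * (3 * r - 1)) +
        (c : ℕ) * (6 * (p + q + r) + 3 * (c : ℕ) + 1) := by
  simp only [coreChange, mul_add, two_mul_natCast_pentagonal_neg]
  simp only [coreExponent]
  ring

variable {R} in
/-- In terms of `q`-Pochhammer symbols, the generating function of 3-cores is
`(q³;q³)_∞³ / (q;q)_∞`. -/
lemma coreSeries_mul_pentagonalSeries [NoZeroDivisors R] (h2 : (2 : R) ≠ 0) :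
    coreSeries R * pentagonalSeries R = expand 3 (by norm_num) (pentagonalSeries R) ^ 3 := by
  have hP : ∀ n : ℤ, {k | (pentagonal k : ℤ) = n}.Finite := fun n => by
    simpa using finite_setOf_mul_pentagonal_eq one_ne_zero n
  have h3 := finite_setOf_mul_pentagonal_eq (a := 3) (by norm_num)
  have hnn : ∀ k : ℤ, (0 : ℤ) ≤ 3 * pentagonal k := fun k => by positivity
  rw [pow_succ, pow_two, pentagonalSeries_eq_thetaSeries, expand_thetaSeries, coreSeries,
    thetaSeries_mul finite_setOf_coreExponent_eq hP coreExponent_nonneg (fun _ => by positivity)]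
  push_cast
  rw [thetaSeries_mul h3 h3 hnn hnn, thetaSeries_mul (finite_setOf_add_eq h3 h3 hnn hnn) h3
      (fun x => add_nonneg (hnn _) (hnn _)) hnn,
    thetaSeries_eq_sum coreChange coreChange_bijective
      (finite_setOf_add_eq finite_setOf_coreExponent_eq hP coreExponent_nonneg
        (fun _ => by positivity)), Fin.sum_univ_three]
  have hflip : Function.Involutive fun x : ℤ => -1 - x := fun x => by ring
  have key := two_mul_exponent_coreChange
  rw [thetaSeries_eq_zero_of_equiv (f := fun i => coreExponent (coreChange (1, i)).1 + _) h2
      (((hflip.toPerm _).prodCongr (Equiv.refl ℤ)).prodCongr (Equiv.refl ℤ)),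
    thetaSeries_eq_zero_of_equiv (f := fun i => coreExponent (coreChange (2, i)).1 + _) h2
      ((Equiv.refl (ℤ × ℤ)).prodCongr (hflip.toPerm _)), add_zero, add_zero]
  · refine thetaSeries_eq_of_equiv
      (((Equiv.neg ℤ).prodCongr (Equiv.neg ℤ)).prodCongr (Equiv.refl ℤ)) ?_ ?_
    · rintro ⟨⟨p, q⟩, r⟩
      have h0 := key 0 p q r
      have hp := two_mul_natCast_pentagonal_neg p
      have hq := two_mul_natCast_pentagonal_neg q
      have hr := two_mul_natCast_pentagonal r
      simp at h0 ⊢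
      linarith
    · rintro ⟨⟨p, q⟩, r⟩
      simp [coreChange, Int.negOnePow_add, Int.negOnePow_neg]
      ring
  · rintro ⟨⟨p, q⟩, r⟩
    have h0 := key 2 p q r
    have h1 := key 2 p q (-1 - r)
    simp at h0 h1 ⊢
    linarith
  · rintro ⟨⟨p, q⟩, r⟩
    simp [coreChange, Int.negOnePow_add, Int.negOnePow_neg]
  · rintro ⟨⟨p, q⟩, r⟩
    have h0 := key 1 p q r
    have h1 := key 1 (-1 - p) q r
    simp at h0 h1 ⊢
    linarith
  · rintro ⟨⟨p, q⟩, r⟩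
    simp [coreChange, Int.negOnePow_add, Int.negOnePow_neg]

end Core

section CharThree

open PowerSeries
open scoped PowerSeries.WithPiTopology

lemma expand_eq_pow (p : ℕ) [Fact p.Prime] (φ : (ZMod p)⟦X⟧) :
    expand p (NeZero.ne p) φ = φ ^ p := by
  have := MvPowerSeries.map_frobenius_expand p (NeZero.ne p) (f := φ)
  rw [ZMod.frobenius_zmod, MvPowerSeries.map_id] at this
  exact this

lemma mk_numRegular_nine :
    (PowerSeries.mk fun n => (numRegular 9 n : ZMod 3)) = pentagonalSeries (ZMod 3) ^ 8 := by
  let _ : TopologicalSpace (ZMod 3) := ⊥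
  have _ : DiscreteTopology (ZMod 3) := ⟨rfl⟩
  have h1 := Nat.Partition.hasProd_powerSeriesMk_card_countRestricted (ZMod 3) (m := 9)
    (by norm_num)
  have h2 := (WithPiTopology.hasProd_one_sub_X_pow (ZMod 3)).pow 8
  have h3 : (3 : (ZMod 3)⟦X⟧) = 0 := by
    have : ((3 : ZMod 3)) = 0 := by decide
    rw [← map_ofNat (C (R := ZMod 3)), this, map_zero]
  have hterm : ∀ i : ℕ, ∑ j ∈ Finset.range 9, (X : (ZMod 3)⟦X⟧) ^ ((i + 1) * j) =
      (1 - X ^ (i + 1)) ^ 8 := by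
    intro i
    simp only [pow_mul]
    generalize (X : (ZMod 3)⟦X⟧) ^ (i + 1) = x
    simp only [Finset.sum_range_succ, Finset.sum_range_zero]
    linear_combination (3 * x - 9 * x ^ 2 + 19 * x ^ 3 - 23 * x ^ 4 + 19 * x ^ 5 - 9 * x ^ 6
      + 3 * x ^ 7) * h3
  simp only [hterm] at h1
  rw [← h1.unique h2]
  congr 1
  ext n
  rw [← Nat.Partition.card_restricted_eq_card_countRestricted n (by norm_num)]
  rfl

lemma mk_numRegular_nine_eq_coreSeries :
    (PowerSeries.mk fun n => (numRegular 9 n : ZMod 3)) = coreSeries (ZMod 3) := by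
  have h := coreSeries_mul_pentagonalSeries (R := ZMod 3) (by decide)
  rw [expand_eq_pow 3] at h
  have h0 : pentagonalSeries (ZMod 3) ≠ 0 := fun h0 => by
    have := coeff_pentagonalSeries_pentagonal (ZMod 3) 0
    simp [h0] at this
  rw [mk_numRegular_nine]
  refine mul_right_cancel₀ h0 ?_
  rw [h]
  ring

end CharThree

/-- The 5-dissection lemma: for every nonnegative `n`, if `n ≢ 1 (mod 5)` then
`b_9(5n+3) ≡ 0 (mod 3)`, and if `n = 5m+1` then `b_9(5n+3) ≡ b_9(m) (mod 3)`;
equivalently `∑ b_9(5n+3) qⁿ ≡ q·(q^45;q^45)_∞/(q^5;q^5)_∞ (mod 3)`. -/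
theorem b9_five_dissection (n : ℕ) :
    (n % 5 ≠ 1 → 3 ∣ numRegular 9 (5 * n + 3)) ∧
    (∀ m : ℕ, n = 5 * m + 1 → numRegular 9 (5 * n + 3) ≡ numRegular 9 m [MOD 3]) := by
  have h : ∀ k : ℕ, (numRegular 9 k : ZMod 3) = PowerSeries.coeff k (coreSeries (ZMod 3)) :=
    fun k => by rw [← mk_numRegular_nine_eq_coreSeries, PowerSeries.coeff_mk]
  constructor
  · intro hn
    rw [← ZMod.natCast_eq_zero_iff, h, coeff_coreSeries_eq_zero _ hn]
  · rintro m rfl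
    rw [← ZMod.natCast_eq_natCast_iff, h, h, show 5 * (5 * m + 1) + 3 = 25 * m + 8 by ring,
      coeff_coreSeries_twentyFive_mul]
end

section
/- For every nonnegative integer n that is not divisible by 5, the number of 3-regular partitions of 5n+2 is divisible by 9, i.e., b_3(5n+2) ≡ 0 (mod 9) whenever 5 ∤ n. -/
open Finset PowerSeries
open scoped PowerSeries.WithPiTopology

theorem ZMod.twelve_eq_zero : (12 : ZMod 12) = 0 := rfl

/-- The even quadratic character modulo `12`, with values in `ℤ`. -/
def chiTwelve : ZMod 12 → ℤ := ![0, 1, 0, 0, 0, -1, 0, -1, 0, 0, 0, 1]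

theorem chiTwelve_mul_add_chiTwelve_mul (u v : ZMod 12) (h : u ^ 2 + v ^ 2 = 10) :
    chiTwelve (2 * u - v) * chiTwelve (u + 2 * v)
      + chiTwelve (2 * u + v) * chiTwelve (2 * v - u) = 0 := by
  revert u v
  decide

theorem chiTwelve_neg (x : ZMod 12) : chiTwelve (-x) = chiTwelve x := by
  revert x
  decide

theorem chiTwelve_six_mul_sub_one (m : ℤ) :
    chiTwelve ((6 * m - 1 : ℤ) : ZMod 12) = Int.negOnePow m := by
  rcases Int.even_or_odd' m with ⟨c, rfl | rfl⟩
  · have : ((6 * (2 * c) - 1 : ℤ) : ZMod 12) = -1 := by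
      push_cast
      linear_combination (c : ZMod 12) * ZMod.twelve_eq_zero
    rw [this, Int.negOnePow_even _ (even_two_mul c)]
    rfl
  · have : ((6 * (2 * c + 1) - 1 : ℤ) : ZMod 12) = 5 := by
      push_cast
      linear_combination (c : ZMod 12) * ZMod.twelve_eq_zero
    rw [this, Int.negOnePow_odd _ (odd_two_mul_add_one c)]
    rfl

/-- Multiplication of `x + y i` by `(2 - i) / (2 + i)` or by `(2 + i) / (2 - i)`, whichever
quotient is a Gaussian integer when the norm of `x + y i` is exactly divisible by `5`. -/
def gaussianFlip (p : ℤ × ℤ) : ℤ × ℤ :=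
  if 5 ∣ 2 * p.1 + p.2 then ((3 * p.1 + 4 * p.2) / 5, (3 * p.2 - 4 * p.1) / 5)
  else ((3 * p.1 - 4 * p.2) / 5, (3 * p.2 + 4 * p.1) / 5)

theorem gaussianFlip_of_left (u v : ℤ) :
    gaussianFlip (2 * u - v, u + 2 * v) = (2 * u + v, 2 * v - u) := by
  have h : (5 : ℤ) ∣ 2 * (2 * u - v) + (u + 2 * v) := ⟨u, by ring⟩
  simp only [gaussianFlip, h, if_true, Prod.mk.injEq]
  constructor <;> omega

theorem gaussianFlip_of_right (u v : ℤ) (h : ¬ 5 ∣ u ^ 2 + v ^ 2) :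
    gaussianFlip (2 * u + v, 2 * v - u) = (2 * u - v, u + 2 * v) := by
  have h' : ¬ (5 : ℤ) ∣ 2 * (2 * u + v) + (2 * v - u) := by
    rintro ⟨k, hk⟩
    refine h ⟨v ^ 2 + 4 * v * (2 * k - 2 * v - u) + 5 * (2 * k - 2 * v - u) ^ 2, ?_⟩
    have hu : u = 2 * v + 5 * (2 * k - 2 * v - u) := by linarith
    linear_combination (u + (2 * v + 5 * (2 * k - 2 * v - u))) * hu
  simp only [gaussianFlip, h', if_false, Prod.mk.injEq]
  constructor <;> omega

theorem exists_gaussian_factor {x y M : ℤ} (h : x ^ 2 + y ^ 2 = 5 * M) :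
    ∃ u v : ℤ, u ^ 2 + v ^ 2 = M ∧
      (x = 2 * u - v ∧ y = u + 2 * v ∨ x = 2 * u + v ∧ y = 2 * v - u) := by
  have hp : (5 : ℤ) ∣ (2 * x + y) * (2 * x - y) := ⟨x ^ 2 - M, by linear_combination -h⟩
  rcases (Int.prime_ofNat_iff.mpr (by norm_num : Nat.Prime 5)).dvd_or_dvd hp with ⟨k, hk⟩ | ⟨k, hk⟩
  · obtain rfl : y = 5 * k - 2 * x := by linarith
    refine ⟨k, 2 * k - x, ?_, Or.inl ⟨by ring, by ring⟩⟩
    linarith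
  · obtain rfl : y = 2 * x - 5 * k := by linarith
    refine ⟨k, x - 2 * k, ?_, Or.inr ⟨by ring, by ring⟩⟩
    linarith

/-- The representations of `N` as a sum of two squares. -/
noncomputable def sumTwoSquares (N : ℕ) : Finset (ℤ × ℤ) :=
  (Icc (-N : ℤ) N ×ˢ Icc (-N : ℤ) N).filter fun p ↦ p.1 ^ 2 + p.2 ^ 2 = N

theorem mem_sumTwoSquares {N : ℕ} {p : ℤ × ℤ} :
    p ∈ sumTwoSquares N ↔ p.1 ^ 2 + p.2 ^ 2 = N := by
  simp only [sumTwoSquares, mem_filter, mem_product, mem_Icc, and_iff_right_iff_imp]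
  intro h
  refine ⟨⟨?_, ?_⟩, ?_, ?_⟩ <;> nlinarith [sq_nonneg p.1, sq_nonneg p.2, Int.le_self_sq p.1,
    Int.le_self_sq p.2, Int.le_self_sq (-p.1), Int.le_self_sq (-p.2)]

theorem sum_chiTwelve_sumTwoSquares {N : ℕ} (hN : N % 5 = 2) (hN' : N % 25 ≠ 2) :
    ∑ p ∈ sumTwoSquares (24 * N + 2),
      chiTwelve (p.1 : ZMod 12) * chiTwelve (p.2 : ZMod 12) = 0 := by
  obtain ⟨n, rfl⟩ : ∃ n, N = 5 * n + 2 := ⟨N / 5, by omega⟩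
  have key (p : ℤ × ℤ) (hp : p ∈ sumTwoSquares (24 * (5 * n + 2) + 2)) :
      ∃ u v : ℤ, u ^ 2 + v ^ 2 = 24 * n + 10 ∧
        (p = (2 * u - v, u + 2 * v) ∧ gaussianFlip p = (2 * u + v, 2 * v - u) ∨
          p = (2 * u + v, 2 * v - u) ∧ gaussianFlip p = (2 * u - v, u + 2 * v)) := by
    rw [mem_sumTwoSquares] at hp
    obtain ⟨u, v, h, hu | hu⟩ := exists_gaussian_factor (x := p.1) (y := p.2)
      (M := 24 * n + 10) (by rw [hp]; push_cast; ring)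
    · obtain rfl : p = (2 * u - v, u + 2 * v) := Prod.ext hu.1 hu.2
      exact ⟨u, v, h, Or.inl ⟨rfl, gaussianFlip_of_left u v⟩⟩
    · obtain rfl : p = (2 * u + v, 2 * v - u) := Prod.ext hu.1 hu.2
      exact ⟨u, v, h, Or.inr ⟨rfl, gaussianFlip_of_right u v (by omega)⟩⟩
  have hchi (p : ℤ × ℤ) (hp : p ∈ sumTwoSquares (24 * (5 * n + 2) + 2)) :
      chiTwelve (p.1 : ZMod 12) * chiTwelve (p.2 : ZMod 12)
        + chiTwelve ((gaussianFlip p).1 : ZMod 12)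
          * chiTwelve ((gaussianFlip p).2 : ZMod 12) = 0 := by
    obtain ⟨u, v, h, hu⟩ := key p hp
    have h' : (u : ZMod 12) ^ 2 + (v : ZMod 12) ^ 2 = 10 := by
      have := congrArg (Int.cast : ℤ → ZMod 12) h
      push_cast at this
      linear_combination this + 2 * (n : ZMod 12) * ZMod.twelve_eq_zero
    have := chiTwelve_mul_add_chiTwelve_mul u v h'
    rcases hu with ⟨hu, hv⟩ | ⟨hu, hv⟩ <;> rw [hv, hu] <;> push_cast <;> linarith
  refine sum_involution (fun p _ ↦ gaussianFlip p) hchi ?_ ?_ ?_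
  · intro p hp hne heq
    have := hchi p hp
    rw [heq] at this
    omega
  · intro p hp
    obtain ⟨u, v, h, ⟨-, hv⟩ | ⟨-, hv⟩⟩ := key p hp <;>
    · rw [mem_sumTwoSquares, hv]
      push_cast
      linear_combination 5 * h
  · intro p hp
    obtain ⟨u, v, h, ⟨hu, hv⟩ | ⟨hu, hv⟩⟩ := key p hp
    · rw [hv, gaussianFlip_of_right u v (by omega), hu]
    · rw [hv, gaussianFlip_of_left, hu]

theorem twentyFour_mul_pentagonal_add_one (m : ℤ) :
    24 * (pentagonal m : ℤ) + 1 = (6 * m - 1) ^ 2 := by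
  linear_combination 12 * two_mul_natCast_pentagonal m

theorem exists_eq_six_mul_sub_one {x k : ℤ} (h : x ^ 2 = 24 * k + 1) :
    ∃ m : ℤ, x = 6 * m - 1 ∨ x = -(6 * m - 1) := by
  have h6 : x ^ 2 % 6 = 1 := by omega
  have : x % 6 = 1 ∨ x % 6 = 5 := by
    have h0 : 0 ≤ x % 6 := Int.emod_nonneg _ (by norm_num)
    have h1 : x % 6 < 6 := Int.emod_lt_of_pos _ (by norm_num)
    rw [pow_two, Int.mul_emod] at h6
    interval_cases x % 6 <;> simp_all
  rcases this with h | h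
  · exact ⟨-(x / 6), Or.inr (by omega)⟩
  · exact ⟨x / 6 + 1, Or.inl (by omega)⟩

theorem pentagonal_eq_of_sq {m : ℤ} {k : ℕ} (h : (6 * m - 1) ^ 2 = 24 * (k : ℤ) + 1) :
    pentagonal m = k := by
  have := twentyFour_mul_pentagonal_add_one m
  omega

theorem sum_chiTwelve_sq_eq {A : Finset ℤ} {k : ℕ} (hA : ∀ x : ℤ, x ^ 2 = 24 * k + 1 → x ∈ A) :
    ∑ x ∈ A with x ^ 2 = 24 * (k : ℤ) + 1, chiTwelve (x : ZMod 12)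
      = 2 * (pentagonalSeries ℤ).coeff k := by
  by_cases hk : k ∈ Set.range pentagonal
  · obtain ⟨m, rfl⟩ := hk
    have hm := twentyFour_mul_pentagonal_add_one m
    have : A.filter (fun x ↦ x ^ 2 = 24 * (pentagonal m : ℤ) + 1) = {6 * m - 1, -(6 * m - 1)} := by
      ext x
      rw [mem_filter, mem_insert, mem_singleton, hm, sq_eq_sq_iff_eq_or_eq_neg,
        and_iff_right_iff_imp]
      intro hx
      exact hA x (by rw [hm]; exact sq_eq_sq_iff_eq_or_eq_neg.mpr hx)
    rw [this, sum_pair (by omega), Int.cast_neg, chiTwelve_neg, chiTwelve_six_mul_sub_one,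
      coeff_pentagonalSeries_pentagonal, two_mul]
    rfl
  · rw [coeff_pentagonalSeries_eq_zero ℤ hk, mul_zero, filter_false_of_mem, sum_empty]
    intro x _ hx
    obtain ⟨m, rfl | rfl⟩ := exists_eq_six_mul_sub_one hx
    · exact hk ⟨m, pentagonal_eq_of_sq hx⟩
    · exact hk ⟨m, pentagonal_eq_of_sq (by rw [← hx, neg_sq])⟩

theorem sq_emod_twentyFour (x : ℤ) :
    x ^ 2 % 24 = 0 ∨ x ^ 2 % 24 = 1 ∨ x ^ 2 % 24 = 4 ∨ x ^ 2 % 24 = 9 ∨ x ^ 2 % 24 = 12 ∨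
      x ^ 2 % 24 = 16 := by
  have h0 : 0 ≤ x % 24 := Int.emod_nonneg _ (by norm_num)
  have h1 : x % 24 < 24 := Int.emod_lt_of_pos _ (by norm_num)
  rw [pow_two, Int.mul_emod]
  interval_cases x % 24 <;> simp

theorem four_mul_coeff_pentagonalSeries_sq (N : ℕ) :
    4 * (pentagonalSeries ℤ ^ 2).coeff N = ∑ p ∈ sumTwoSquares (24 * N + 2),
      chiTwelve (p.1 : ZMod 12) * chiTwelve (p.2 : ZMod 12) := by
  have hsq (x k : ℤ) (hx : x ^ 2 = 24 * k + 1) : ((x ^ 2 - 1) / 24) = k := by omega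
  have hsol {x y : ℤ} (h : x ^ 2 + y ^ 2 = (24 * N + 2 : ℕ)) :
      ∃ i j : ℕ, i + j = N ∧ x ^ 2 = 24 * i + 1 ∧ y ^ 2 = 24 * j + 1 := by
    have hx := sq_emod_twentyFour x
    have hy := sq_emod_twentyFour y
    have := sq_nonneg x
    have := sq_nonneg y
    exact ⟨((x ^ 2 - 1) / 24).toNat, ((y ^ 2 - 1) / 24).toNat, by omega, by omega, by omega⟩
  set A := Icc (-(24 * N + 2 : ℕ) : ℤ) (24 * N + 2 : ℕ)
  have hA (k : ℕ) (hk : k ≤ N) (x : ℤ) (hx : x ^ 2 = 24 * k + 1) : x ∈ A := by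
    have := Int.le_self_sq x
    have := Int.le_self_sq (-x)
    rw [neg_sq] at this
    rw [mem_Icc]
    omega
  rw [pow_two, coeff_mul, mul_sum]
  rw [← sum_fiberwise_of_maps_to (t := antidiagonal N)
    (g := fun p : ℤ × ℤ ↦ (((p.1 ^ 2 - 1) / 24).toNat, ((p.2 ^ 2 - 1) / 24).toNat))]
  · refine sum_congr rfl fun ij hij ↦ ?_
    rw [HasAntidiagonal.mem_antidiagonal] at hij
    have h := congrArg₂ (· * ·) (sum_chiTwelve_sq_eq (hA ij.1 (by omega)))
      (sum_chiTwelve_sq_eq (hA ij.2 (by omega)))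
    simp only [sum_mul_sum, ← sum_product'] at h
    rw [mul_mul_mul_comm] at h
    refine h.symm.trans ?_
    refine sum_congr ?_ fun _ _ ↦ rfl
    ext p
    rw [mem_product, mem_filter, mem_filter, mem_filter, mem_sumTwoSquares]
    constructor
    · rintro ⟨⟨-, hx⟩, -, hy⟩
      refine ⟨by rw [hx, hy, ← hij]; push_cast; ring, ?_⟩
      simp [hsq _ _ hx, hsq _ _ hy]
    · rintro ⟨hp, rfl⟩
      obtain ⟨i, j, hN, hx, hy⟩ := hsol hp
      simp only [hsq _ _ hx, hsq _ _ hy, Int.toNat_natCast]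
      exact ⟨⟨hA i (by omega) _ hx, hx⟩, hA j (by omega) _ hy, hy⟩
  · intro p hp
    obtain ⟨i, j, hN, hx, hy⟩ := hsol (mem_sumTwoSquares.mp hp)
    simpa [hsq _ _ hx, hsq _ _ hy] using hN

theorem coeff_pentagonalSeries_sq_eq_zero {N : ℕ} (hN : N % 5 = 2) (hN' : N % 25 ≠ 2) :
    (pentagonalSeries ℤ ^ 2).coeff N = 0 := by
  have := four_mul_coeff_pentagonalSeries_sq N
  rw [sum_chiTwelve_sumTwoSquares hN hN'] at this
  omega

/-- The Lambert series term `X ^ d / (1 - X ^ d)`. -/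
noncomputable def lambertTerm (R : Type*) [CommRing R] (d : ℕ) : R⟦X⟧ :=
  .mk fun k ↦ if d ∣ k ∧ k ≠ 0 then 1 else 0

/-- The term `X ^ d / (1 - X ^ d) ^ 2`. -/
noncomputable def lambertSqTerm (R : Type*) [CommRing R] (d : ℕ) : R⟦X⟧ :=
  .mk fun k ↦ if d ∣ k then ((k / d : ℕ) : R) else 0

section
variable {R : Type*} [CommRing R]

theorem one_sub_X_pow_mul_lambertTerm {d : ℕ} (hd : d ≠ 0) :
    (1 - X ^ d) * lambertTerm R d = X ^ d := by
  ext k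
  rw [sub_mul, one_mul, map_sub, coeff_X_pow_mul', coeff_X_pow]
  simp only [lambertTerm, coeff_mk]
  by_cases hk : d ∣ k
  · obtain ⟨c, rfl⟩ := hk
    rcases c with _ | _ | c
    · simp [hd.symm]
    · simp [hd]
    · simp [mul_add, hd]
  · have hkd : k ≠ d := fun h ↦ hk (h ▸ dvd_rfl)
    by_cases h : d ≤ k
    · have : ¬ d ∣ k - d := fun h' ↦ hk ((Nat.dvd_sub_iff_left h dvd_rfl).mp h')
      simp [hk, hkd, this]
    · simp [hk, hkd, h]

theorem one_sub_X_pow_mul_lambertSqTerm {d : ℕ} (hd : d ≠ 0) :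
    (1 - X ^ d) * lambertSqTerm R d = lambertTerm R d := by
  ext k
  rw [sub_mul, one_mul, map_sub, coeff_X_pow_mul']
  simp only [lambertTerm, lambertSqTerm, coeff_mk]
  by_cases hk : d ∣ k
  · obtain ⟨c, rfl⟩ := hk
    rcases c with _ | c
    · simp
    · simp [mul_add, hd, Nat.pos_of_ne_zero hd]
  · by_cases h : d ≤ k
    · have : ¬ d ∣ k - d := fun h' ↦ hk ((Nat.dvd_sub_iff_left h dvd_rfl).mp h')
      simp [hk, this]
    · simp [hk, h]

theorem coeff_sum_lambertSqTerm {M j : ℕ} (hj : j ≤ M) :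
    (∑ n ∈ range M, lambertSqTerm R (n + 1)).coeff j
      = (∑ n ∈ range M, ((n + 1 : ℕ) : R⟦X⟧) * lambertTerm R (n + 1)).coeff j := by
  simp only [map_sum, ← map_natCast (C (R := R)), coeff_C_mul, lambertSqTerm, lambertTerm,
    coeff_mk, mul_ite, mul_one, mul_zero]
  rcases eq_or_ne j 0 with rfl | hj0
  · simp
  have hsub : j.divisors = ((range M).map (addRightEmbedding 1)).filter (· ∣ j) := by
    ext d
    simp only [Nat.mem_divisors, mem_filter, mem_map, mem_range, addRightEmbedding_apply]
    constructor
    · rintro ⟨h, -⟩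
      have := Nat.pos_of_dvd_of_pos h (Nat.pos_of_ne_zero hj0)
      have := Nat.le_of_dvd (Nat.pos_of_ne_zero hj0) h
      exact ⟨⟨d - 1, by omega, by omega⟩, h⟩
    · exact fun h ↦ ⟨h.2, hj0⟩
  have h := Nat.sum_div_divisors j (fun d ↦ (d : R))
  rw [hsub, sum_filter, sum_filter] at h
  simpa [hj0] using h

theorem X_mul_derivative_prod (s : Finset ℕ) :
    X * d⁄dX R (∏ n ∈ s, (1 - X ^ (n + 1)))
      = -(∏ n ∈ s, (1 - X ^ (n + 1)))
        * ∑ n ∈ s, ((n + 1 : ℕ) : R⟦X⟧) * lambertTerm R (n + 1) := by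
  induction s using Finset.induction_on with
  | empty => simp
  | insert a s ha ih =>
    rw [prod_insert ha, sum_insert ha, Derivation.leibniz, map_sub, derivative_pow]
    have h := one_sub_X_pow_mul_lambertTerm (R := R) a.succ_ne_zero
    simp only [smul_eq_mul, derivative_X, derivative_one, Nat.succ_eq_add_one,
      Nat.add_sub_cancel] at h ⊢
    linear_combination (1 - X ^ (a + 1)) * ih
      + ((a + 1 : ℕ) : R⟦X⟧) * (∏ n ∈ s, (1 - X ^ (n + 1))) * h

theorem prod_geom_three (h9 : (9 : R) = 0) (s : Finset ℕ) :
    ∏ n ∈ s, (1 + X ^ (n + 1) + (X ^ (n + 1)) ^ 2 : R⟦X⟧)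
      = (∏ n ∈ s, (1 - X ^ (n + 1))) ^ 2 * (1 + 3 * ∑ n ∈ s, lambertSqTerm R (n + 1)) := by
  have h9' : (9 : R⟦X⟧) = 0 := by
    rw [← map_ofNat (C (R := R)) 9, ← map_zero (C (R := R))]
    exact congrArg _ h9
  induction s using Finset.induction_on with
  | empty => simp
  | insert a s ha ih =>
    have h1 := one_sub_X_pow_mul_lambertTerm (R := R) (d := a + 1) a.succ_ne_zero
    have h2 := one_sub_X_pow_mul_lambertSqTerm (R := R) (d := a + 1) a.succ_ne_zero
    have h : (1 - X ^ (a + 1)) ^ 2 * lambertSqTerm R (a + 1) = X ^ (a + 1) := by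
      linear_combination (1 - X ^ (a + 1)) * h2 + h1
    rw [prod_insert ha, prod_insert ha, sum_insert ha, ih]
    linear_combination (-3 * (∏ n ∈ s, (1 - X ^ (n + 1))) ^ 2
        * (1 + 3 * ∑ n ∈ s, lambertSqTerm R (n + 1))) * h
      + ((1 - X ^ (a + 1)) ^ 2 * lambertSqTerm R (a + 1) * (∏ n ∈ s, (1 - X ^ (n + 1))) ^ 2
        * ∑ n ∈ s, lambertSqTerm R (n + 1)) * h9'

theorem coeff_X_mul_derivative (f : R⟦X⟧) (N : ℕ) :
    (X * d⁄dX R f).coeff N = N * f.coeff N := by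
  cases N with
  | zero => simp
  | succ N =>
    rw [coeff_succ_X_mul, coeff_derivative, mul_comm]
    push_cast
    rfl

theorem coeff_mul_congr {f g g' : R⟦X⟧} {N : ℕ} (h : ∀ j ≤ N, g.coeff j = g'.coeff j) :
    (f * g).coeff N = (f * g').coeff N := by
  rw [coeff_mul, coeff_mul]
  refine sum_congr rfl fun ij hij ↦ ?_
  rw [h ij.2 (by rw [HasAntidiagonal.mem_antidiagonal] at hij; omega)]

theorem two_mul_coeff_prod_geom_three (h9 : (9 : R) = 0) {N M : ℕ} (hM : N ≤ M) :
    2 * (∏ n ∈ range M, (1 + X ^ (n + 1) + (X ^ (n + 1)) ^ 2 : R⟦X⟧)).coeff N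
      = (2 - 3 * N) * ((∏ n ∈ range M, (1 - X ^ (n + 1) : R⟦X⟧)) ^ 2).coeff N := by
  set P : R⟦X⟧ := ∏ n ∈ range M, (1 - X ^ (n + 1)) with hP
  have hD : 2 * (P ^ 2 * ∑ n ∈ range M, ((n + 1 : ℕ) : R⟦X⟧) * lambertTerm R (n + 1))
      = -(X * d⁄dX R (P ^ 2)) := by
    have := X_mul_derivative_prod (R := R) (range M)
    rw [← hP] at this
    rw [derivative_pow]
    push_cast at this ⊢
    linear_combination (2 * P) * this
  have hS : 2 * (P ^ 2 * ∑ n ∈ range M, lambertSqTerm R (n + 1)).coeff N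
      = -(N * (P ^ 2).coeff N) := by
    rw [coeff_mul_congr (fun j hj ↦ coeff_sum_lambertSqTerm (hj.trans hM)),
      ← coeff_X_mul_derivative, ← map_neg, ← hD, two_mul, two_mul, map_add]
  have h2 (f : R⟦X⟧) : (f * (1 + 3 * ∑ n ∈ range M, lambertSqTerm R (n + 1))).coeff N
      = f.coeff N + 3 * (f * ∑ n ∈ range M, lambertSqTerm R (n + 1)).coeff N := by
    rw [← coeff_C_mul, map_ofNat, ← map_add]
    ring_nf
  rw [prod_geom_three h9, h2]
  linear_combination 3 * hS

end

theorem coeff_prod_geom_three_eventually_eq (R : Type*) [CommRing R] (N : ℕ) :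
    ∀ᶠ s in Filter.atTop, (∏ n ∈ s, (1 + X ^ (n + 1) + (X ^ (n + 1)) ^ 2 : R⟦X⟧)).coeff N
      = (numRegular 3 N : R) := by
  let : TopologicalSpace R := ⊥
  have : DiscreteTopology R := ⟨rfl⟩
  have h := Nat.Partition.hasProd_powerSeriesMk_card_countRestricted R (m := 3) (by norm_num)
  rw [HasProd, WithPiTopology.tendsto_iff_coeff_tendsto] at h
  have hcard : numRegular 3 N = #(Nat.Partition.countRestricted N 3) :=
    Nat.Partition.card_restricted_eq_card_countRestricted N (by norm_num)
  simpa [sum_range_succ, pow_mul, hcard] using h N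

theorem coeff_sq_congr {R : Type*} [CommRing R] {f g : R⟦X⟧} {N : ℕ}
    (h : ∀ j ≤ N, f.coeff j = g.coeff j) : (f ^ 2).coeff N = (g ^ 2).coeff N := by
  rw [pow_two, pow_two, coeff_mul_congr h, mul_comm, coeff_mul_congr h]

theorem two_mul_numRegular_three (N : ℕ) :
    (2 * numRegular 3 N : ZMod 9)
      = (2 - 3 * N) * ((pentagonalSeries ℤ ^ 2).coeff N : ℤ) := by
  have hP : ∀ᶠ s in Filter.atTop, ∀ j ∈ range (N + 1),
      (∏ n ∈ s, (1 - X ^ (n + 1) : (ZMod 9)⟦X⟧)).coeff j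
        = (pentagonalSeries (ZMod 9)).coeff j :=
    (Filter.eventually_all_finset _).mpr fun j _ ↦ coeff_prod_one_sub_X_pow_eventually_eq _ j
  obtain ⟨M, hG, hP, hM⟩ := (Filter.tendsto_finset_range.eventually
    (coeff_prod_geom_three_eventually_eq (ZMod 9) N)).and ((Filter.tendsto_finset_range.eventually
      hP).and (Filter.eventually_ge_atTop N)) |>.exists
  have hmap : map (Int.castRingHom (ZMod 9)) (pentagonalSeries ℤ)
      = pentagonalSeries (ZMod 9) := by
    ext k
    by_cases hk : k ∈ Set.range pentagonal
    · obtain ⟨m, rfl⟩ := hk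
      simp
    · simp [coeff_pentagonalSeries_eq_zero _ hk]
  rw [← hG, two_mul_coeff_prod_geom_three rfl hM,
    coeff_sq_congr (fun j hj ↦ hP j (mem_range.mpr (by omega))), ← hmap, ← map_pow, coeff_map]
  rfl

/-- If `5 ∤ n` then `b_3(5n+2) ≡ 0 (mod 9)`. -/
theorem b3_five_n_two_mod_nine (n : ℕ) (hn : ¬ 5 ∣ n) : 9 ∣ numRegular 3 (5 * n + 2) := by
  have h := two_mul_numRegular_three (5 * n + 2)
  rw [coeff_pentagonalSeries_sq_eq_zero (by omega) (by omega), Int.cast_zero, mul_zero] at h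
  have h2 : 9 ∣ 2 * numRegular 3 (5 * n + 2) := by
    rw [← ZMod.natCast_eq_zero_iff]
    exact_mod_cast h
  exact Nat.Coprime.dvd_of_dvd_mul_left (by norm_num) h2
end
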